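/- arXiv:1912.09324 — 2 statements merged into one kernel-verified Lean document; each statement's English description precedes it below -/
import Mathlib

section
/- Let f ∈ C([0,∞)) (independent of |x|) and let u be a weak solution of problem (P) in B_R which is also a global minimizer of J in X. Then u is positive in B_R, radially symmetric and radially non-increasing, i.e. u(x) = U(|x|) with U ∈ C^1([0,R]) non-increasing; moreover there is R' ∈ [0,R) such that U'(r) < 0 for r ∈ (R',R) and U(r) is constant for r ∈ [0,R']. -/
open Set Metric MeasureTheory Bornology
open scoped RealInnerProductSpace Classical

noncomputable section

/-- The vector field `y ↦ (g(|y|)/|y|)·y`, with the convention that it vanishes at `y = 0`. -/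
def gvec {N : ℕ} (g : ℝ → ℝ) (y : EuclideanSpace ℝ (Fin N)) : EuclideanSpace ℝ (Fin N) :=
  if y = 0 then 0 else (g ‖y‖ / ‖y‖) • y

/-- `φ` is a smooth test function compactly supported in `Ω`. -/
def IsTestFun {N : ℕ} (Ω : Set (EuclideanSpace ℝ (Fin N)))
    (φ : EuclideanSpace ℝ (Fin N) → ℝ) : Prop :=
  ContDiff ℝ (⊤ : ℕ∞) φ ∧ HasCompactSupport φ ∧ tsupport φ ⊆ Ω

/-- Conditions (2.1)-(2.2): `g ∈ C[0,∞) ∩ C¹(0,∞)`, `g(0) = 0`, `g'(t) > 0` for `t > 0`. -/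
def GCond (g : ℝ → ℝ) : Prop :=
  ContinuousOn g (Ici 0) ∧ ContDiffOn ℝ 1 g (Ioi 0) ∧ g 0 = 0 ∧
    ∀ t : ℝ, 0 < t → 0 < deriv g t

/-- Conditions (2.3)-(2.4): `f ∈ C([0,R] × [0,∞))`, `r ↦ f(r,t)` non-increasing. -/
def FCond (R : ℝ) (f : ℝ → ℝ → ℝ) : Prop :=
  ContinuousOn (fun q : ℝ × ℝ => f q.1 q.2) (Icc 0 R ×ˢ Ici 0) ∧
    ∀ t : ℝ, 0 ≤ t → ∀ r₁ ∈ Icc (0:ℝ) R, ∀ r₂ ∈ Icc (0:ℝ) R, r₁ ≤ r₂ → f r₂ t ≤ f r₁ t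

/-- `u` solves `-div((g(|∇u|)/|∇u|)∇u) = f(|x|,u)` distributionally in the ball `B_R`. -/
def IsDistribSolBall {N : ℕ} (R : ℝ) (g : ℝ → ℝ) (f : ℝ → ℝ → ℝ)
    (u : EuclideanSpace ℝ (Fin N) → ℝ) : Prop :=
  ∀ φ : EuclideanSpace ℝ (Fin N) → ℝ, IsTestFun (ball 0 R) φ →
    (∫ x in ball (0:EuclideanSpace ℝ (Fin N)) R, ⟪gvec g (gradient u x), gradient φ x⟫) =
      ∫ x in ball (0:EuclideanSpace ℝ (Fin N)) R, f ‖x‖ (u x) * φ x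

/-- `u` is a weak solution of problem (P): `u ∈ C¹(clos B_R)`, `u ≥ 0`, `u ≢ 0`,
`u = 0` on `∂B_R`, and the equation holds distributionally. -/
def IsWeakSolP {N : ℕ} (R : ℝ) (g : ℝ → ℝ) (f : ℝ → ℝ → ℝ)
    (u : EuclideanSpace ℝ (Fin N) → ℝ) : Prop :=
  ContDiffOn ℝ 1 u (closedBall 0 R) ∧
  (∀ x ∈ closedBall (0:EuclideanSpace ℝ (Fin N)) R, 0 ≤ u x) ∧
  (∃ x ∈ closedBall (0:EuclideanSpace ℝ (Fin N)) R, u x ≠ 0) ∧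
  (∀ x ∈ sphere (0:EuclideanSpace ℝ (Fin N)) R, u x = 0) ∧
  IsDistribSolBall R g f u

/-- `U` is `C¹` on `[a,b]` with (continuous) derivative `U'`. -/
def C1On (U U' : ℝ → ℝ) (a b : ℝ) : Prop :=
  ContinuousOn U' (Icc a b) ∧ ∀ r ∈ Icc a b, HasDerivWithinAt U (U' r) (Icc a b) r

/-- Definition 2.1: `u` is locally symmetric in `B_R`. -/
def LocallySymmetric {N : ℕ} (R : ℝ) (u : EuclideanSpace ℝ (Fin N) → ℝ) : Prop :=
  ∃ (K : Set ℕ) (z : ℕ → EuclideanSpace ℝ (Fin N)) (ri ro : ℕ → ℝ) (U U' : ℕ → ℝ → ℝ),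
    (∀ k ∈ K, z k ∈ ball (0:EuclideanSpace ℝ (Fin N)) R ∧ 0 ≤ ri k ∧ ri k < ro k) ∧
    K.PairwiseDisjoint (fun k => ball (z k) (ro k) \ closedBall (z k) (ri k)) ∧
    ball (0:EuclideanSpace ℝ (Fin N)) R =
      (⋃ k ∈ K, ball (z k) (ro k) \ closedBall (z k) (ri k)) ∪
        {x ∈ ball (0:EuclideanSpace ℝ (Fin N)) R | gradient u x = 0} ∧
    ∀ k ∈ K,
      C1On (U k) (U' k) (ri k) (ro k) ∧
      (∀ x ∈ ball (z k) (ro k) \ closedBall (z k) (ri k), u x = U k ‖x - z k‖) ∧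
      (∀ r ∈ Ioo (ri k) (ro k), U' k r < 0) ∧
      (∀ x ∈ ball (z k) (ri k), U k (ri k) ≤ u x)

/-- `H(t) = t·g(t) - ∫₀ᵗ g(s) ds`. -/
def Hfun (g : ℝ → ℝ) (t : ℝ) : ℝ := t * g t - ∫ s in (0:ℝ)..t, g s

/-- The inverse of `H` on `[0,∞)`. -/
def Hinv (g : ℝ → ℝ) : ℝ → ℝ := Function.invFunOn (Hfun g) (Ici 0)

/-- The class `A_g` of Definition 3.1. -/
def MemAg (g φ : ℝ → ℝ) : Prop :=
  ContinuousOn φ (Ici 0) ∧ (∀ t : ℝ, 0 ≤ t → 0 ≤ φ t) ∧ φ 0 = 0 ∧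
  ((∃ d > (0:ℝ), ∀ t ∈ Icc (0:ℝ) d, φ t = 0) ∨
    ∃ δ > (0:ℝ), (∀ t ∈ Ioo (0:ℝ) δ, 0 < φ t) ∧
      ∫⁻ t in Ioc (0:ℝ) δ, ENNReal.ofReal (1 / Hinv g (∫ s in (0:ℝ)..t, φ s)) = ⊤)

/-- `u` satisfies `div((g(|∇u|)/|∇u|)∇u) ≤ φ(u)` distributionally in `Ω`. -/
def DistribSupIneq {N : ℕ} (Ω : Set (EuclideanSpace ℝ (Fin N))) (g φ : ℝ → ℝ)
    (u : EuclideanSpace ℝ (Fin N) → ℝ) : Prop :=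
  ∀ ψ : EuclideanSpace ℝ (Fin N) → ℝ, IsTestFun Ω ψ → (∀ x, 0 ≤ ψ x) →
    -(∫ x in Ω, ⟪gvec g (gradient u x), gradient ψ x⟫) ≤ ∫ x in Ω, φ (u x) * ψ x

/-- Condition (a) of Lemma 3.7. -/
def CondA (R : ℝ) (g : ℝ → ℝ) (f : ℝ → ℝ → ℝ) : Prop :=
  ∀ ρ ∈ Ico (0:ℝ) R, ∀ τ : ℝ, 0 < τ → f ρ τ = 0 →
    ∃ δ ∈ Ioo (0:ℝ) τ, ∃ φ : ℝ → ℝ, MemAg g φ ∧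
      ∀ t ∈ Icc (τ - δ) τ, ∀ r ∈ Icc (ρ - δ) (ρ + δ) ∩ Icc (0:ℝ) R, f r t ≤ φ (τ - t)

/-- Condition (b) of Lemma 3.8. -/
def CondB (R : ℝ) (g : ℝ → ℝ) (f : ℝ → ℝ → ℝ) : Prop :=
  ∀ ρ ∈ Ico (0:ℝ) R, f ρ 0 = 0 →
    ∃ δ > (0:ℝ), ∃ φ : ℝ → ℝ, MemAg g φ ∧
      ∀ r ∈ Ico (0:ℝ) R, ∀ t ∈ Icc (0:ℝ) δ, -f r t ≤ φ t

/-- Condition (c) of Theorem 3.9. -/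
def CondC (R : ℝ) (g : ℝ → ℝ) (f : ℝ → ℝ → ℝ) : Prop :=
  ∀ ρ ∈ Ico (0:ℝ) R, ∀ τ : ℝ, 0 ≤ τ → f ρ τ = 0 →
    ∃ δ > (0:ℝ), ∃ φ : ℝ → ℝ, MemAg g φ ∧
      ∀ t ∈ Icc τ (τ + δ), ∀ r ∈ Icc (ρ - δ) (ρ + δ) ∩ Icc (0:ℝ) R, -f r t ≤ φ (t - τ)

/-- `u` solves `-div((g(|∇u|)/|∇u|)∇u) = f(u)` distributionally in `Ω` (autonomous case). -/
def IsDistribSolAut {N : ℕ} (Ω : Set (EuclideanSpace ℝ (Fin N))) (g f : ℝ → ℝ)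
    (u : EuclideanSpace ℝ (Fin N) → ℝ) : Prop :=
  ∀ φ : EuclideanSpace ℝ (Fin N) → ℝ, IsTestFun Ω φ →
    (∫ x in Ω, ⟪gvec g (gradient u x), gradient φ x⟫) = ∫ x in Ω, f (u x) * φ x

/-- `u` is a weak solution of problem (P) with autonomous right-hand side `f = f(u)`. -/
def IsWeakSolPAut {N : ℕ} (R : ℝ) (g f : ℝ → ℝ) (u : EuclideanSpace ℝ (Fin N) → ℝ) : Prop :=
  ContDiffOn ℝ 1 u (closedBall 0 R) ∧
  (∀ x ∈ closedBall (0:EuclideanSpace ℝ (Fin N)) R, 0 ≤ u x) ∧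
  (∃ x ∈ closedBall (0:EuclideanSpace ℝ (Fin N)) R, u x ≠ 0) ∧
  (∀ x ∈ sphere (0:EuclideanSpace ℝ (Fin N)) R, u x = 0) ∧
  IsDistribSolAut (ball 0 R) g f u

/-- `G(t) = ∫₀ᵗ g(s) ds`. -/
def Gfun (g : ℝ → ℝ) (t : ℝ) : ℝ := ∫ s in (0:ℝ)..t, g s

/-- The variational functional `J(v) = ∫_Ω (G(|∇v|) - F(v)) dx`. -/
def Jfun {N : ℕ} (g f : ℝ → ℝ) (Ω : Set (EuclideanSpace ℝ (Fin N)))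
    (v : EuclideanSpace ℝ (Fin N) → ℝ) : ℝ :=
  ∫ x in Ω, (Gfun g ‖gradient v x‖ - Gfun f (v x))

/-- `v ∈ X`, i.e. `v ∈ C¹(clos Ω)` with `v = 0` on `∂Ω`. -/
def MemX {N : ℕ} (Ω : Set (EuclideanSpace ℝ (Fin N)))
    (v : EuclideanSpace ℝ (Fin N) → ℝ) : Prop :=
  ContDiffOn ℝ 1 v (closure Ω) ∧ ∀ x ∈ frontier Ω, v x = 0

/-- `u` is a global minimizer of `J` in `X`. -/
def IsGlobalMinJ {N : ℕ} (g f : ℝ → ℝ) (Ω : Set (EuclideanSpace ℝ (Fin N)))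
    (u : EuclideanSpace ℝ (Fin N) → ℝ) : Prop :=
  MemX Ω u ∧ ∀ v, MemX Ω v → Jfun g f Ω u ≤ Jfun g f Ω v

/-- `u` is a local minimizer of `J` in `X` (w.r.t. the `C¹` distance). -/
def IsLocalMinJ {N : ℕ} (g f : ℝ → ℝ) (Ω : Set (EuclideanSpace ℝ (Fin N)))
    (u : EuclideanSpace ℝ (Fin N) → ℝ) : Prop :=
  MemX Ω u ∧ ∃ ε > (0:ℝ), ∀ v, MemX Ω v →
    (∀ x ∈ Ω, |v x - u x| + ‖gradient v x - gradient u x‖ < ε) →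
    Jfun g f Ω u ≤ Jfun g f Ω v

/-- `Ω` has `C¹` boundary: near every boundary point, `Ω` is the sublevel set of a `C¹`
defining function with nonvanishing gradient. -/
def HasC1Boundary {N : ℕ} (Ω : Set (EuclideanSpace ℝ (Fin N))) : Prop :=
  ∀ y ∈ frontier Ω, ∃ (V : Set (EuclideanSpace ℝ (Fin N))) (ρ : EuclideanSpace ℝ (Fin N) → ℝ),
    IsOpen V ∧ y ∈ V ∧ ContDiffOn ℝ 1 ρ V ∧ (∀ x ∈ V, (x ∈ Ω ↔ ρ x < 0)) ∧ gradient ρ y ≠ 0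

/-- The Neumann condition `∂u/∂ν = 0` on `∂Ω`; for `u ∈ X` (so that `u` vanishes on the
boundary and all tangential derivatives vanish) this is equivalent to the vanishing of the
full derivative of `u` (within `clos Ω`) at every boundary point. -/
def NeumannZero {N : ℕ} (Ω : Set (EuclideanSpace ℝ (Fin N)))
    (u : EuclideanSpace ℝ (Fin N) → ℝ) : Prop :=
  ∀ y ∈ frontier Ω, HasFDerivWithinAt u (0 : EuclideanSpace ℝ (Fin N) →L[ℝ] ℝ) (closure Ω) y

/-- `u` is radially symmetric and radially non-increasing on `clos B_R`, with `C¹`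
profile `U` (with derivative `U'`). -/
def RadialNonincreasing {N : ℕ} (R : ℝ) (u : EuclideanSpace ℝ (Fin N) → ℝ)
    (U U' : ℝ → ℝ) : Prop :=
  C1On U U' 0 R ∧ AntitoneOn U (Icc 0 R) ∧
    ∀ x ∈ closedBall (0:EuclideanSpace ℝ (Fin N)) R, u x = U ‖x‖

end

/-- odd extension of `g` -/
noncomputable def gh (g : ℝ → ℝ) (p : ℝ) : ℝ := if 0 ≤ p then g p else - g (-p)

/-- primitive of the odd extension of `g` -/
noncomputable def Gh (g : ℝ → ℝ) (p : ℝ) : ℝ := ∫ s in (0:ℝ)..p, gh g s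

/-- Legendre-type energy -/
noncomputable def Hh (g : ℝ → ℝ) (p : ℝ) : ℝ := p * gh g p - Gh g p

lemma g_strictMonoOn {g : ℝ → ℝ} (hg : GCond g) : StrictMonoOn g (Ici 0) := by
  apply strictMonoOn_of_deriv_pos (convex_Ici 0) hg.1
  intro x hx
  rw [interior_Ici] at hx
  exact hg.2.2.2 x hx

lemma g_pos {g : ℝ → ℝ} (hg : GCond g) {t : ℝ} (ht : 0 < t) : 0 < g t := by
  have := g_strictMonoOn hg (mem_Ici.2 le_rfl) (mem_Ici.2 ht.le) ht
  rwa [hg.2.2.1] at this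

lemma gh_zero {g : ℝ → ℝ} (hg : GCond g) : gh g 0 = 0 := by simp [gh, hg.2.2.1]

lemma gh_neg {g : ℝ → ℝ} (hg : GCond g) (p : ℝ) : gh g (-p) = - gh g p := by
  unfold gh
  rcases lt_trichotomy p 0 with h | h | h
  · rw [if_pos (by linarith), if_neg (by linarith)]; ring
  · subst h; simp [hg.2.2.1]
  · rw [if_neg (by linarith), if_pos h.le]; simp

lemma gh_of_nonneg {g : ℝ → ℝ} {p : ℝ} (hp : 0 ≤ p) : gh g p = g p := if_pos hp

lemma gh_strictMono {g : ℝ → ℝ} (hg : GCond g) : StrictMono (gh g) := by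
  have hp : ∀ p, 0 < p → 0 < gh g p := fun p hp => by
    rw [gh_of_nonneg hp.le]; exact g_pos hg hp
  have hn : ∀ p, p < 0 → gh g p < 0 := fun p hp' => by
    have := hp (-p) (by linarith)
    rw [gh_neg hg] at this; linarith
  intro p q hpq
  rcases le_or_gt 0 p with h | h
  · rw [gh_of_nonneg h, gh_of_nonneg (h.trans hpq.le)]
    exact g_strictMonoOn hg h (h.trans hpq.le) hpq
  · rcases le_or_gt 0 q with h' | h'
    · refine (hn p h).trans_le ?_
      rcases h'.eq_or_lt with h0 | h0
      · rw [← h0, gh_zero hg]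
      · exact (hp q h0).le
    · have := g_strictMonoOn hg (mem_Ici.2 (by linarith : (0:ℝ) ≤ -q))
        (mem_Ici.2 (by linarith : (0:ℝ) ≤ -p)) (by linarith)
      unfold gh
      rw [if_neg (by linarith), if_neg (by linarith)]
      linarith

lemma gh_continuous {g : ℝ → ℝ} (hg : GCond g) : Continuous (gh g) := by
  have h1 : Continuous (fun p => g (max p 0)) :=
    hg.1.comp_continuous (by fun_prop) (fun x => by simp)
  have h2 : Continuous (fun p => g (max (-p) 0)) :=
    hg.1.comp_continuous (by fun_prop) (fun x => by simp)
  have : gh g = fun p => g (max p 0) - g (max (-p) 0) := by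
    funext p
    unfold gh
    split_ifs with h
    · rw [max_eq_left h, max_eq_right (by linarith), hg.2.2.1]; ring
    · push Not at h
      rw [max_eq_right h.le, max_eq_left (by linarith), hg.2.2.1]; ring
  rw [this]
  exact h1.sub h2

lemma Gh_hasDerivAt {g : ℝ → ℝ} (hg : GCond g) (p : ℝ) : HasDerivAt (Gh g) (gh g p) p :=
  intervalIntegral.integral_hasDerivAt_right ((gh_continuous hg).intervalIntegrable _ _)
    ((gh_continuous hg).stronglyMeasurableAtFilter _ _) (gh_continuous hg).continuousAt

lemma Gh_continuous {g : ℝ → ℝ} (hg : GCond g) : Continuous (Gh g) :=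
  continuous_iff_continuousAt.2 fun p => (Gh_hasDerivAt hg p).continuousAt

lemma Gh_zero (g : ℝ → ℝ) : Gh g 0 = 0 := by simp [Gh]

lemma Gh_neg {g : ℝ → ℝ} (hg : GCond g) (p : ℝ) : Gh g (-p) = Gh g p := by
  unfold Gh
  have := intervalIntegral.integral_comp_neg (a := 0) (b := p) (fun s => gh g s)
  simp only [gh_neg hg, neg_zero] at this
  rw [intervalIntegral.integral_neg] at this
  rw [intervalIntegral.integral_symm, ← this]; ring

lemma Gh_abs {g : ℝ → ℝ} (hg : GCond g) (p : ℝ) : Gh g |p| = Gh g p := by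
  rcases abs_choice p with h | h <;> rw [h]
  exact Gh_neg hg p

lemma Gfun_eq {g : ℝ → ℝ} {t : ℝ} (ht : 0 ≤ t) : Gfun g t = Gh g t := by
  unfold Gfun Gh
  apply intervalIntegral.integral_congr
  intro s hs
  rw [uIcc_of_le ht] at hs
  exact (gh_of_nonneg hs.1).symm

/-- convexity -/
lemma Gh_convex {g : ℝ → ℝ} (hg : GCond g) (p q : ℝ) :
    gh g p * (q - p) ≤ Gh g q - Gh g p := by
  have hInt : ∀ a b, IntervalIntegrable (gh g) volume a b :=
    fun a b => (gh_continuous hg).intervalIntegrable _ _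
  have h : Gh g q - Gh g p = ∫ s in p..q, gh g s := by
    unfold Gh
    rw [intervalIntegral.integral_interval_sub_left (hInt _ _) (hInt _ _)]
  rw [h]
  rcases le_total p q with hpq | hpq
  · have := intervalIntegral.integral_mono_on (μ := volume) hpq (f := fun _ => gh g p) (g := gh g)
      (by simp) (hInt _ _) (fun x hx => (gh_strictMono hg).monotone hx.1)
    simp at this
    linarith
  · rw [intervalIntegral.integral_symm]
    have := intervalIntegral.integral_mono_on (μ := volume) hpq (g := fun _ => gh g p) (f := gh g)
      (hInt _ _) (by simp) (fun x hx => (gh_strictMono hg).monotone hx.2)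
    simp at this
    linarith

lemma Gh_strictMonoOn {g : ℝ → ℝ} (hg : GCond g) : StrictMonoOn (Gh g) (Ici 0) := by
  apply strictMonoOn_of_deriv_pos (convex_Ici 0) (Gh_continuous hg).continuousOn
  intro x hx
  rw [interior_Ici] at hx
  rw [(Gh_hasDerivAt hg x).deriv, ← gh_zero hg]
  exact gh_strictMono hg hx

lemma Hh_sub_ge {g : ℝ → ℝ} (hg : GCond g) (p q : ℝ) :
    p * (gh g q - gh g p) ≤ Hh g q - Hh g p := by
  have := Gh_convex hg q p
  unfold Hh; linarith

lemma Hh_sub_le {g : ℝ → ℝ} (hg : GCond g) (p q : ℝ) :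
    Hh g q - Hh g p ≤ q * (gh g q - gh g p) := by
  have := Gh_convex hg p q
  unfold Hh; linarith

lemma Hh_zero (g : ℝ → ℝ) : Hh g 0 = 0 := by simp [Hh, Gh_zero]

lemma Hh_abs {g : ℝ → ℝ} (hg : GCond g) (p : ℝ) : Hh g |p| = Hh g p := by
  rcases abs_choice p with h | h <;> rw [h]
  simp [Hh, Gh_neg hg, gh_neg hg]

lemma Hh_strictMonoOn {g : ℝ → ℝ} (hg : GCond g) : StrictMonoOn (Hh g) (Ici 0) := by
  intro p hp q hq hpq
  have hp : 0 ≤ p := hp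
  have h1 := Hh_sub_ge hg p ((p+q)/2)
  have h2 := Hh_sub_ge hg ((p+q)/2) q
  have h3 : gh g p < gh g ((p+q)/2) := gh_strictMono hg (by linarith)
  have h4 : gh g ((p+q)/2) < gh g q := gh_strictMono hg (by linarith)
  have h5 : 0 ≤ p * (gh g ((p+q)/2) - gh g p) := mul_nonneg hp (by linarith)
  have h6 : 0 < ((p+q)/2) * (gh g q - gh g ((p+q)/2)) := mul_pos (by linarith) (by linarith)
  linarith

lemma Hh_inj {g : ℝ → ℝ} (hg : GCond g) {p q : ℝ} (h : Hh g p = Hh g q) : |p| = |q| := by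
  rw [← Hh_abs hg p, ← Hh_abs hg q] at h
  exact (Hh_strictMonoOn hg).injOn (abs_nonneg p) (abs_nonneg q) h

lemma mul_gh_nonneg {g : ℝ → ℝ} (hg : GCond g) (p : ℝ) : 0 ≤ p * gh g p := by
  have h0 := gh_zero hg
  rcases le_total 0 p with h | h
  · exact mul_nonneg h (h0 ▸ (gh_strictMono hg).monotone h)
  · exact mul_nonneg_of_nonpos_of_nonpos h (h0 ▸ (gh_strictMono hg).monotone h)

lemma mul_gh_eq_zero {g : ℝ → ℝ} (hg : GCond g) {p : ℝ} (h : p * gh g p = 0) : p = 0 := by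
  rcases mul_eq_zero.1 h with h | h
  · exact h
  · rw [← gh_zero hg] at h; exact (gh_strictMono hg).injective h

/-- The energy lemma. -/
lemma energy_hasDerivAt {g : ℝ → ℝ} (hg : GCond g) {p : ℝ → ℝ} {r w' : ℝ}
    (hp : ContinuousAt p r) (hw : HasDerivAt (fun s => gh g (p s)) w' r) :
    HasDerivAt (fun s => Hh g (p s)) (p r * w') r := by
  rw [hasDerivAt_iff_tendsto_slope] at hw ⊢
  have hp' : Filter.Tendsto p (nhdsWithin r {r}ᶜ) (nhds (p r)) := hp.tendsto.mono_left nhdsWithin_le_nhds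
  have hlow := hw.const_mul (p r)
  have hup := hp'.mul hw
  have key : ∀ s, s ≠ r → slope (fun s => Hh g (p s)) r s ∈
      uIcc (p r * slope (fun s => gh g (p s)) r s) (p s * slope (fun s => gh g (p s)) r s) := by
    intro s hs
    have h1 := Hh_sub_ge hg (p r) (p s)
    have h2 := Hh_sub_le hg (p r) (p s)
    simp only [slope_def_field]
    rw [mem_uIcc]
    rcases lt_or_gt_of_ne hs with h | h
    · right
      constructor
      · rw [mul_div_assoc', div_le_div_right_of_neg (by linarith)]; exact h2
      · rw [mul_div_assoc', div_le_div_right_of_neg (by linarith)]; exact h1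
    · left
      constructor
      · rw [mul_div_assoc', div_le_div_iff_of_pos_right (by linarith)]; exact h1
      · rw [mul_div_assoc', div_le_div_iff_of_pos_right (by linarith)]; exact h2
  have hmin := hlow.min hup
  have hmax := hlow.max hup
  rw [min_self] at hmin
  rw [max_self] at hmax
  refine tendsto_of_tendsto_of_tendsto_of_le_of_le' hmin hmax ?_ ?_
  · filter_upwards [self_mem_nhdsWithin] with s hs using (key s hs).1
  · filter_upwards [self_mem_nhdsWithin] with s hs using (key s hs).2


lemma compact_sub_Ioo {α β r : ℝ} {K : Set ℝ} (hK : IsCompact K) (hs : K ⊆ Ioo α β)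
    (hr : r ∈ Ioo α β) : ∃ a b, α < a ∧ a < b ∧ b < β ∧ K ⊆ Ioo a b := by
  have hK' : IsCompact (insert r K) := hK.insert r
  have hne : (insert r K).Nonempty := ⟨r, mem_insert _ _⟩
  have hs' : insert r K ⊆ Ioo α β := insert_subset hr hs
  have h1 := hs' (hK'.sInf_mem hne)
  have h2 := hs' (hK'.sSup_mem hne)
  have h3 : sInf (insert r K) ≤ sSup (insert r K) :=
    csInf_le_csSup hne hK'.bddBelow hK'.bddAbove
  refine ⟨(α + sInf (insert r K)) / 2, (β + sSup (insert r K)) / 2, by linarith [h1.1],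
    by linarith [h1.1, h2.2], by linarith [h2.2], fun x hx => ?_⟩
  have h4 := csInf_le hK'.bddBelow (mem_insert_of_mem r hx)
  have h5 := le_csSup hK'.bddAbove (mem_insert_of_mem r hx)
  exact ⟨by linarith [h1.1], by linarith [h2.2]⟩

/-- du Bois-Reymond lemma -/
lemma dbr {α β : ℝ} {a b : ℝ → ℝ} (ha : ContinuousOn a (Ioo α β)) (hb : ContinuousOn b (Ioo α β))
    (h : ∀ ψ : ℝ → ℝ, ContDiff ℝ (⊤ : ℕ∞) ψ → HasCompactSupport ψ → tsupport ψ ⊆ Ioo α β →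
      ∫ x in Ioo α β, a x * deriv ψ x = ∫ x in Ioo α β, b x * ψ x) :
    ∀ r ∈ Ioo α β, HasDerivAt a (- b r) r := by
  intro r hr
  set B : ℝ → ℝ := fun s => ∫ t in r..s, b t with hB
  have hBd : ∀ s ∈ Ioo α β, HasDerivAt B (b s) s := by
    intro s hs
    apply intervalIntegral.integral_hasDerivAt_right
    · apply ContinuousOn.intervalIntegrable
      exact hb.mono (ordConnected_Ioo.uIcc_subset hr hs)
    · exact hb.stronglyMeasurableAtFilter isOpen_Ioo s hs
    · exact hb.continuousAt (isOpen_Ioo.mem_nhds hs)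
  have hBc : ContinuousOn B (Ioo α β) := fun s hs => (hBd s hs).continuousAt.continuousWithinAt
  have hcut : ∀ (q ψ : ℝ → ℝ) (a' b' : ℝ), α < a' → a' < b' → b' < β →
      (∀ x, x ∉ Ioo a' b' → ψ x = 0) →
      ∫ x in Ioo α β, q x * ψ x = ∫ x in a'..b', q x * ψ x := by
    intro q ψ a' b' h1 h2 h3 h4
    rw [intervalIntegral.integral_of_le h2.le, integral_Ioc_eq_integral_Ioo]
    apply setIntegral_eq_of_subset_of_forall_sdiff_eq_zero measurableSet_Ioo (Ioo_subset_Ioo h1.le h3.le)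
    intro x hx
    rw [h4 x hx.2, mul_zero]
  have hIntg : ∀ (q ψ : ℝ → ℝ), ContinuousOn q (Ioo α β) → Continuous ψ → HasCompactSupport ψ →
      tsupport ψ ⊆ Ioo α β → IntegrableOn (fun x => q x * ψ x) (Ioo α β) := by
    intro q ψ hq hψ hc hs
    obtain ⟨a', b', h1, h2, h3, h4⟩ := compact_sub_Ioo hc hs hr
    have : IntegrableOn (fun x => q x * ψ x) (Icc a' b') := by
      apply ContinuousOn.integrableOn_Icc
      exact (hq.mono (Icc_subset_Ioo h1 h3)).mul hψ.continuousOn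
    apply this.of_forall_sdiff_eq_zero measurableSet_Ioo
    intro x hx
    have : ψ x = 0 := by
      by_contra hne
      exact hx.2 (Ioo_subset_Icc_self (h4 (subset_tsupport _ hne)))
    rw [this, mul_zero]
  set c : ℝ → ℝ := fun s => a s + B s with hc
  have hcc : ContinuousOn c (Ioo α β) := ha.add hBc
  -- step 1
  have s1 : ∀ ψ : ℝ → ℝ, ContDiff ℝ (⊤ : ℕ∞) ψ → HasCompactSupport ψ → tsupport ψ ⊆ Ioo α β →
      ∫ x in Ioo α β, c x * deriv ψ x = 0 := by
    intro ψ hψ hψc hψs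
    obtain ⟨a', b', h1, h2, h3, h4⟩ := compact_sub_Ioo hψc hψs hr
    have hz : ∀ x, x ∉ Ioo a' b' → ψ x = 0 := fun x hx => by
      by_contra hne
      exact hx (h4 (subset_tsupport _ hne))
    have hz' : ∀ x, x ∉ Ioo a' b' → deriv ψ x = 0 := fun x hx => by
      by_contra hne
      exact hx (h4 (support_deriv_subset hne))
    have hdc : Continuous (deriv ψ) := hψ.continuous_deriv (by norm_cast)
    have hdiff : Differentiable ℝ ψ := hψ.differentiable (by simp)
    have e1 := h ψ hψ hψc hψs
    rw [hcut b ψ a' b' h1 h2 h3 hz] at e1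
    have hsub : uIcc a' b' ⊆ Ioo α β := by
      rw [uIcc_of_le h2.le]; exact Icc_subset_Ioo h1 h3
    have e2 : ∫ x in a'..b', B x * deriv ψ x = B b' * ψ b' - B a' * ψ a' - ∫ x in a'..b', b x * ψ x :=
      intervalIntegral.integral_mul_deriv_eq_deriv_mul (fun x hx => hBd x (hsub hx))
        (fun x _ => (hdiff x).hasDerivAt) ((hb.mono hsub).intervalIntegrable)
        (hdc.intervalIntegrable _ _)
    rw [hz b' (by simp), hz a' (by simp)] at e2
    have e3 : ∫ x in Ioo α β, c x * deriv ψ x =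
        (∫ x in Ioo α β, a x * deriv ψ x) + ∫ x in Ioo α β, B x * deriv ψ x := by
      rw [← integral_add]
      · congr 1; ext x; simp only [hc]; ring
      · exact hIntg a _ ha hdc hψc.deriv ((tsupport_deriv_subset).trans hψs)
      · exact hIntg B _ hBc hdc hψc.deriv ((tsupport_deriv_subset).trans hψs)
    rw [e3, hcut B (deriv ψ) a' b' h1 h2 h3 hz', e1, e2]; ring
  -- step 2
  obtain ⟨δ, hδ, hδs⟩ := Metric.isOpen_iff.1 isOpen_Ioo r hr
  let bump : ContDiffBump r := ⟨δ/4, δ/2, by linarith, by linarith⟩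
  set ζ : ℝ → ℝ := bump.normed volume with hζ
  have hζd : ContDiff ℝ (⊤ : ℕ∞) ζ := bump.contDiff_normed
  have hζc : HasCompactSupport ζ := bump.hasCompactSupport_normed
  have hζs : tsupport ζ ⊆ Ioo α β := by
    rw [hζ, bump.tsupport_normed_eq]
    exact (closedBall_subset_ball (by change δ/2 < δ; linarith)).trans hδs
  have hζ1 : ∫ x, ζ x = 1 := bump.integral_normed
  set k : ℝ := ∫ x in Ioo α β, c x * ζ x with hk
  have s3 : ∀ χ : ℝ → ℝ, ContDiff ℝ (⊤ : ℕ∞) χ → HasCompactSupport χ → tsupport χ ⊆ Ioo α β →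
      ∫ x, χ x • ((Ioo α β).indicator (fun x => c x - k) x) = 0 := by
    intro χ hχ hχc hχs
    set I : ℝ := ∫ x, χ x with hI
    set η : ℝ → ℝ := fun x => χ x - I * ζ x with hη
    have hηd : ContDiff ℝ (⊤ : ℕ∞) η := hχ.sub (contDiff_const.mul hζd)
    have hηc : HasCompactSupport η := hχc.sub (hζc.mul_left)
    have hηs : tsupport η ⊆ Ioo α β := by
      refine (closure_minimal (t := tsupport χ ∪ tsupport ζ) ?_
        ((isClosed_tsupport _).union (isClosed_tsupport _))).trans (union_subset hχs hζs)
      intro x hx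
      by_contra hne
      simp only [mem_union, not_or] at hne
      apply hx
      simp [hη, image_eq_zero_of_notMem_tsupport hne.1, image_eq_zero_of_notMem_tsupport hne.2]
    have hηi : ∫ x, η x = 0 := by
      simp only [hη]
      rw [integral_sub, integral_const_mul, hζ1]
      · simp [hI]
      · exact hχ.continuous.integrable_of_hasCompactSupport hχc
      · exact (hζd.continuous.integrable_of_hasCompactSupport hζc).const_mul _
    obtain ⟨a', b', h1, h2, h3, h4⟩ := compact_sub_Ioo hηc hηs hr
    have hz : ∀ x, x ∉ Ioo a' b' → η x = 0 := fun x hx => by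
      by_contra hne
      exact hx (h4 (subset_tsupport _ hne))
    set ψ : ℝ → ℝ := fun s => ∫ t in a'..s, η t with hψ
    have hψd : ∀ s, HasDerivAt ψ (η s) s := fun s =>
      intervalIntegral.integral_hasDerivAt_right (hηd.continuous.intervalIntegrable _ _)
        (hηd.continuous.stronglyMeasurableAtFilter _ _) hηd.continuous.continuousAt
    have hψ' : deriv ψ = η := funext fun s => (hψd s).deriv
    have hψcd : ContDiff ℝ (⊤ : ℕ∞) ψ := by
      rw [contDiff_infty_iff_deriv]
      exact ⟨fun s => (hψd s).differentiableAt, by rw [hψ']; exact hηd⟩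
    have hψz : ∀ s, s ∉ Icc a' b' → ψ s = 0 := by
      intro s hs
      rcases lt_or_ge s a' with hs1 | hs1
      · rw [hψ]
        apply intervalIntegral.integral_zero_ae
        refine Filter.Eventually.of_forall fun t ht => hz t ?_
        rw [uIoc_of_ge hs1.le] at ht
        simp only [mem_Ioo, not_and_or, not_lt]
        left; exact ht.2
      · have hs2 : b' < s := by
          by_contra hcon
          exact hs ⟨hs1, not_lt.1 hcon⟩
        change ∫ t in a'..s, η t = 0
        rw [intervalIntegral.integral_of_le hs1, ← hηi]
        apply setIntegral_eq_integral_of_forall_compl_eq_zero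
        intro x hx
        apply hz
        intro hx'
        exact hx ⟨hx'.1, hx'.2.le.trans hs2.le⟩
    have hψsupp : tsupport ψ ⊆ Icc a' b' := by
      apply closure_minimal _ isClosed_Icc
      intro s hs
      by_contra hcon
      exact hs (hψz s hcon)
    have hψc : HasCompactSupport ψ := isCompact_Icc.of_isClosed_subset (isClosed_tsupport _) hψsupp
    have e := s1 ψ hψcd hψc (hψsupp.trans (Icc_subset_Ioo h1 h3))
    rw [hψ'] at e
    have i1 := hIntg c χ hcc hχ.continuous hχc hχs
    have i2 := hIntg c ζ hcc hζd.continuous hζc hζs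
    have e2 : ∫ x in Ioo α β, c x * η x = (∫ x in Ioo α β, c x * χ x) - I * k := by
      rw [hk, ← integral_const_mul, ← integral_sub i1 (i2.const_mul I)]
      congr 1; ext x; simp only [hη]; ring
    have e3 : ∫ x in Ioo α β, χ x = I := by
      apply setIntegral_eq_integral_of_forall_compl_eq_zero
      intro x hx
      by_contra hne
      exact hx (hχs (subset_tsupport _ hne))
    have e4 : ∫ x, χ x • ((Ioo α β).indicator (fun x => c x - k) x) =
        ∫ x in Ioo α β, (c x * χ x - k * χ x) := by
      rw [← integral_indicator measurableSet_Ioo]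
      congr 1; ext x
      by_cases hx : x ∈ Ioo α β
      · simp only [indicator_of_mem hx, smul_eq_mul]; ring
      · simp [indicator_of_notMem hx]
    have i3 : IntegrableOn (fun x => k * χ x) (Ioo α β) :=
      ((hχ.continuous.integrable_of_hasCompactSupport hχc).const_mul k).integrableOn
    rw [e4, integral_sub i1 i3, integral_const_mul, e3]
    rw [e2] at e
    linarith
  have hli : LocallyIntegrableOn ((Ioo α β).indicator (fun x => c x - k)) (Ioo α β) volume := by
    apply ContinuousOn.locallyIntegrableOn _ measurableSet_Ioo
    exact (hcc.sub continuousOn_const).congr (fun x hx => indicator_of_mem hx _)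
  have hae := isOpen_Ioo.ae_eq_zero_of_integral_contDiff_smul_eq_zero hli s3
  have heq : EqOn c (fun _ => k) (Ioo α β) := by
    apply Measure.eqOn_open_of_ae_eq (μ := volume) _ isOpen_Ioo hcc continuousOn_const
    rw [Filter.EventuallyEq, ae_restrict_iff' measurableSet_Ioo]
    filter_upwards [hae] with x hx hxm
    have := hx hxm
    rw [indicator_of_mem hxm] at this
    linarith
  have hfin : HasDerivAt (fun s => k - B s) (- b r) r := (hBd r hr).const_sub k
  apply hfin.congr_of_eventuallyEq
  filter_upwards [isOpen_Ioo.mem_nhds hr] with s hs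
  have := heq hs
  simp only [hc] at this
  linarith


lemma Gfun_continuous {f : ℝ → ℝ} (hf : Continuous f) : Continuous (Gfun f) :=
  continuous_iff_continuousAt.2 fun p => HasDerivAt.continuousAt (f' := f p)
    (intervalIntegral.integral_hasDerivAt_right (hf.intervalIntegrable _ _)
    (hf.stronglyMeasurableAtFilter _ _) hf.continuousAt)

lemma Gfun_hasDerivAt {f : ℝ → ℝ} (hf : Continuous f) (p : ℝ) : HasDerivAt (Gfun f) (f p) p :=
  intervalIntegral.integral_hasDerivAt_right (hf.intervalIntegrable _ _)
    (hf.stronglyMeasurableAtFilter _ _) hf.continuousAt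

section
variable {N : ℕ}

lemma uniqueDiffOn_cb {R : ℝ} (hR : 0 < R) :
    UniqueDiffOn ℝ (closedBall (0 : EuclideanSpace ℝ (Fin N)) R) := by
  apply uniqueDiffOn_convex (convex_closedBall _ _)
  rw [interior_closedBall _ hR.ne']
  exact ⟨0, mem_ball_self hR⟩

lemma hasFDerivAt_of_within {R : ℝ} {u : EuclideanSpace ℝ (Fin N) → ℝ}
    {L : EuclideanSpace ℝ (Fin N) →L[ℝ] ℝ} {x : EuclideanSpace ℝ (Fin N)} (hx : x ∈ ball 0 R)
    (h : HasFDerivWithinAt u L (closedBall 0 R) x) : HasFDerivAt u L x :=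
  h.hasFDerivAt (Filter.mem_of_superset (isOpen_ball.mem_nhds hx) ball_subset_closedBall)

lemma norm_gradient_eq {u : EuclideanSpace ℝ (Fin N) → ℝ}
    {L : EuclideanSpace ℝ (Fin N) →L[ℝ] ℝ} {x : EuclideanSpace ℝ (Fin N)}
    (h : HasFDerivAt u L x) : ‖gradient u x‖ = ‖L‖ := by
  rw [gradient, h.fderiv]; simp

lemma inner_gradient_eq {u : EuclideanSpace ℝ (Fin N) → ℝ}
    {L : EuclideanSpace ℝ (Fin N) →L[ℝ] ℝ} {x : EuclideanSpace ℝ (Fin N)}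
    (h : HasFDerivAt u L x) (y : EuclideanSpace ℝ (Fin N)) : ⟪gradient u x, y⟫ = L y := by
  rw [inner_gradient_left, h.fderiv]

lemma J_eq {R : ℝ} {g f : ℝ → ℝ} {u : EuclideanSpace ℝ (Fin N) → ℝ}
    {D : EuclideanSpace ℝ (Fin N) → (EuclideanSpace ℝ (Fin N) →L[ℝ] ℝ)}
    (hD : ∀ x ∈ closedBall 0 R, HasFDerivWithinAt u (D x) (closedBall 0 R) x) :
    Jfun g f (ball 0 R) u = ∫ x in ball 0 R, (Gh g ‖D x‖ - Gfun f (u x)) := by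
  unfold Jfun
  apply setIntegral_congr_fun measurableSet_ball
  intro x hx
  have := norm_gradient_eq (hasFDerivAt_of_within hx (hD x (ball_subset_closedBall hx)))
  simp only [this, Gfun_eq (norm_nonneg _)]

lemma J_integrable {R : ℝ} {g f : ℝ → ℝ} (hg : GCond g) (hf : Continuous f)
    {u : EuclideanSpace ℝ (Fin N) → ℝ}
    {D : EuclideanSpace ℝ (Fin N) → (EuclideanSpace ℝ (Fin N) →L[ℝ] ℝ)}
    (hDc : ContinuousOn D (closedBall 0 R)) (huc : ContinuousOn u (closedBall 0 R)) :
    IntegrableOn (fun x => Gh g ‖D x‖ - Gfun f (u x)) (ball 0 R) := by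
  have : ContinuousOn (fun x => Gh g ‖D x‖ - Gfun f (u x)) (closedBall 0 R) :=
    ((Gh_continuous hg).comp_continuousOn hDc.norm).sub ((Gfun_continuous hf).comp_continuousOn huc)
  exact (this.integrableOn_compact (isCompact_closedBall _ _)).mono_set ball_subset_closedBall

lemma competitor {R d : ℝ} {u : EuclideanSpace ℝ (Fin N) → ℝ}
    {D : EuclideanSpace ℝ (Fin N) → (EuclideanSpace ℝ (Fin N) →L[ℝ] ℝ)}
    (hDc : ContinuousOn D (closedBall 0 R))
    (hD : ∀ x ∈ closedBall 0 R, HasFDerivWithinAt u (D x) (closedBall 0 R) x)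
    {A : Set (EuclideanSpace ℝ (Fin N))} (hA : IsClosed A)
    (hfr : ∀ x ∈ frontier A, x ∈ closedBall 0 R → u x = d ∧ D x = 0) :
    ContinuousOn (fun x => if x ∈ A then 0 else D x) (closedBall 0 R) ∧
    ∀ x ∈ closedBall 0 R, HasFDerivWithinAt (fun x => if x ∈ A then d else u x)
      (if x ∈ A then 0 else D x) (closedBall 0 R) x := by
  constructor
  · apply ContinuousOn.if
    · intro x hx
      exact (hfr x hx.2 hx.1).2.symm
    · exact continuousOn_const
    · exact hDc.mono inter_subset_left
  · intro x hx
    by_cases hxA : x ∈ A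
    · rw [if_pos hxA]
      by_cases hxi : x ∈ interior A
      · apply HasFDerivAt.hasFDerivWithinAt
        apply (hasFDerivAt_const d x).congr_of_eventuallyEq
        filter_upwards [isOpen_interior.mem_nhds hxi] with y hy
        rw [if_pos (interior_subset hy)]
      · have hf := hfr x (by rw [frontier, hA.closure_eq]; exact ⟨hxA, hxi⟩) hx
        have h1 := hD x hx
        rw [hf.2, hasFDerivWithinAt_iff_isLittleO] at h1
        rw [hasFDerivWithinAt_iff_isLittleO]
        refine Asymptotics.IsBigO.trans_isLittleO (Asymptotics.isBigO_of_le _ fun y => ?_) h1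
        simp only [if_pos hxA, zero_apply, sub_zero, hf.1]
        split_ifs
        · simp
        · exact le_rfl
    · rw [if_neg hxA]
      apply (hD x hx).congr_of_eventuallyEq
      · filter_upwards [nhdsWithin_le_nhds (hA.isOpen_compl.mem_nhds hxA)] with y hy
        rw [if_neg hy]
      · rw [if_neg hxA]

lemma contDiffOn_of {R : ℝ} (hR : 0 < R) {u : EuclideanSpace ℝ (Fin N) → ℝ}
    {D : EuclideanSpace ℝ (Fin N) → (EuclideanSpace ℝ (Fin N) →L[ℝ] ℝ)}
    (hDc : ContinuousOn D (closedBall 0 R))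
    (hD : ∀ x ∈ closedBall 0 R, HasFDerivWithinAt u (D x) (closedBall 0 R) x) :
    ContDiffOn ℝ 1 u (closedBall 0 R) := by
  have := (contDiffOn_succ_iff_hasFDerivWithinAt_of_uniqueDiffOn (𝕜 := ℝ) (n := 0) (f := u)
    (uniqueDiffOn_cb (N := N) hR)).2 ⟨by simp, D, contDiffOn_zero.2 hDc, hD⟩
  simpa using this

lemma exists_D {R : ℝ} (hR : 0 < R) {u : EuclideanSpace ℝ (Fin N) → ℝ}
    (h : ContDiffOn ℝ 1 u (closedBall 0 R)) :
    ∃ D : EuclideanSpace ℝ (Fin N) → (EuclideanSpace ℝ (Fin N) →L[ℝ] ℝ),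
      ContinuousOn D (closedBall 0 R) ∧
      ∀ x ∈ closedBall 0 R, HasFDerivWithinAt u (D x) (closedBall 0 R) x := by
  have h' : ContDiffOn ℝ (0 + 1) u (closedBall 0 R) := by simpa using h
  obtain ⟨_, D, h1, h2⟩ := (contDiffOn_succ_iff_hasFDerivWithinAt_of_uniqueDiffOn (𝕜 := ℝ) (n := 0)
    (f := u) (uniqueDiffOn_cb (N := N) hR)).1 h'
  exact ⟨D, contDiffOn_zero.1 h1, h2⟩

/-- minimality among nonnegative competitors -/
def MinNN (R : ℝ) (g f : ℝ → ℝ) (u : EuclideanSpace ℝ (Fin N) → ℝ) : Prop :=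
  ∀ v, ContDiffOn ℝ 1 v (closedBall 0 R) →
    (∀ x ∈ sphere (0 : EuclideanSpace ℝ (Fin N)) R, v x = 0) →
    (∀ x ∈ closedBall (0 : EuclideanSpace ℝ (Fin N)) R, 0 ≤ v x) →
    Jfun g f (ball 0 R) u ≤ Jfun g f (ball 0 R) v

lemma comp_ineq {R d : ℝ} (hR : 0 < R) {g f : ℝ → ℝ} (hg : GCond g) (hf : Continuous f)
    {u : EuclideanSpace ℝ (Fin N) → ℝ}
    {D : EuclideanSpace ℝ (Fin N) → (EuclideanSpace ℝ (Fin N) →L[ℝ] ℝ)}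
    (hDc : ContinuousOn D (closedBall 0 R))
    (hD : ∀ x ∈ closedBall 0 R, HasFDerivWithinAt u (D x) (closedBall 0 R) x)
    (hu0 : ∀ x ∈ sphere (0 : EuclideanSpace ℝ (Fin N)) R, u x = 0)
    (hupos : ∀ x ∈ closedBall (0 : EuclideanSpace ℝ (Fin N)) R, 0 ≤ u x)
    (hmin : MinNN R g f u)
    {A : Set (EuclideanSpace ℝ (Fin N))} (hA : IsClosed A)
    (hfr : ∀ x ∈ frontier A, x ∈ closedBall 0 R → u x = d ∧ D x = 0)
    (hd : 0 ≤ d) (hAs : ∀ x ∈ A, x ∈ sphere (0 : EuclideanSpace ℝ (Fin N)) R → d = 0) :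
    ∫ x in ball 0 R ∩ A, (Gh g ‖D x‖ - Gfun f (u x) + Gfun f d) ≤ 0 := by
  obtain ⟨h1, h2⟩ := competitor hDc hD hA hfr
  have huc : ContinuousOn u (closedBall 0 R) := fun x hx => (hD x hx).continuousWithinAt
  have hvc : ContinuousOn (fun x => if x ∈ A then d else u x) (closedBall 0 R) :=
    fun x hx => (h2 x hx).continuousWithinAt
  have h3 := hmin _ (contDiffOn_of hR h1 h2) (fun x hx => by
    split_ifs with h
    · exact hAs x h hx
    · exact hu0 x hx) (fun x hx => by
    split_ifs with h
    · exact hd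
    · exact hupos x hx)
  rw [J_eq hD, J_eq h2] at h3
  have i1 := J_integrable hg hf hDc huc
  have i2 := J_integrable hg hf h1 hvc
  rw [← integral_inter_add_sdiff hA.measurableSet i1, ← integral_inter_add_sdiff hA.measurableSet i2] at h3
  have e1 : ∫ x in ball 0 R \ A, (Gh g ‖if x ∈ A then 0 else D x‖ - Gfun f (if x ∈ A then d else u x))
      = ∫ x in ball 0 R \ A, (Gh g ‖D x‖ - Gfun f (u x)) := by
    apply setIntegral_congr_fun (measurableSet_ball.diff hA.measurableSet)
    intro x hx
    simp only [if_neg hx.2]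
  have e2 : ∫ x in ball 0 R ∩ A, (Gh g ‖if x ∈ A then 0 else D x‖ - Gfun f (if x ∈ A then d else u x))
      = ∫ x in ball 0 R ∩ A, (- Gfun f d) := by
    apply setIntegral_congr_fun (measurableSet_ball.inter hA.measurableSet)
    intro x hx
    simp only [if_pos hx.2, norm_zero, Gh_zero, zero_sub]
  rw [e1, e2] at h3
  have i3 : IntegrableOn (fun x => Gh g ‖D x‖ - Gfun f (u x)) (ball 0 R ∩ A) :=
    i1.mono_set inter_subset_left
  have i4 : IntegrableOn (fun _ : EuclideanSpace ℝ (Fin N) => Gfun f d) (ball 0 R ∩ A) := by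
    apply integrableOn_const
    · exact ((measure_mono inter_subset_left).trans_lt measure_ball_lt_top).ne
    · simp
  rw [integral_add i3 i4]
  rw [integral_neg] at h3
  linarith

end


section
variable {N : ℕ}

lemma nontrivial_E (hN : 1 ≤ N) : Nontrivial (EuclideanSpace ℝ (Fin N)) := by
  apply Module.nontrivial_of_finrank_pos (R := ℝ)
  simp; omega

lemma exists_dir_aux {E : Type*} [NormedAddCommGroup E] [NormedSpace ℝ E] [FiniteDimensional ℝ E]
    [MeasurableSpace E] [BorelSpace E] [Nontrivial E] (μ : Measure E) [μ.IsAddHaarMeasure]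
    {R : ℝ} (Ψ : E → ℝ) (hΨ : IntegrableOn Ψ (ball 0 R) μ) :
    ∃ e : E, ‖e‖ = 1 ∧
      ∫ x in ball (0 : E) R, Ψ (‖x‖ • e) ∂μ ≤ ∫ x in ball 0 R, Ψ x ∂μ := by
  set χ : E → ℝ := (ball (0 : E) R).indicator Ψ with hχ
  have hχi : Integrable χ μ := (integrable_indicator_iff measurableSet_ball).2 hΨ
  set σ := μ.toSphere
  set τ := Measure.volumeIoiPow (Module.finrank ℝ E - 1)
  have hmp := μ.measurePreserving_homeomorphUnitSphereProd
  have hsm : ∀ x : ({0}ᶜ : Set E), ‖(x : E)‖ • ((‖(x : E)‖)⁻¹ • (x : E)) = x := by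
    intro x
    have : ‖(x : E)‖ ≠ 0 := norm_ne_zero_iff.2 x.2
    rw [smul_smul, mul_inv_cancel₀ this, one_smul]
  have e1 : ∫ x, χ x ∂μ = ∫ p : sphere (0 : E) 1 × Ioi (0 : ℝ), χ ((p.2 : ℝ) • (p.1 : E)) ∂σ.prod τ := by
    rw [← hmp.integral_comp (Homeomorph.measurableEmbedding _)]
    simp only [homeomorphUnitSphereProd_apply_snd_coe, homeomorphUnitSphereProd_apply_fst_coe, hsm]
    rw [integral_subtype_comap (measurableSet_singleton _).compl χ, restrict_compl_singleton]
  have i1 : Integrable (fun p : sphere (0 : E) 1 × Ioi (0 : ℝ) => χ ((p.2 : ℝ) • (p.1 : E))) (σ.prod τ) := by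
    rw [← hmp.integrable_comp_emb (Homeomorph.measurableEmbedding _)]
    simp only [Function.comp_def, homeomorphUnitSphereProd_apply_snd_coe, homeomorphUnitSphereProd_apply_fst_coe, hsm]
    have := (integrableOn_iff_comap_subtypeVal (μ := μ) (f := χ) (measurableSet_singleton (0 : E)).compl).1
      hχi.integrableOn
    exact this
  have i2 := i1.integral_prod_left
  have hσ : σ ≠ 0 := by simp [σ]
  obtain ⟨e, he⟩ := exists_le_average hσ i2
  have hen : ‖(e : E)‖ = 1 := by simpa using e.2
  refine ⟨e, hen, ?_⟩
  have e2 : ∫ x in ball (0 : E) R, Ψ (‖x‖ • (e : E)) ∂μ = ∫ x, χ (‖x‖ • (e : E)) ∂μ := by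
    rw [← integral_indicator measurableSet_ball]
    congr 1; ext x
    simp only [hχ, indicator, mem_ball_zero_iff, norm_smul, hen, norm_norm, mul_one]
  have e3 : ∫ x, χ (‖x‖ • (e : E)) ∂μ = σ.real univ * ∫ r : Ioi (0:ℝ), χ ((r : ℝ) • (e : E)) ∂τ := by
    calc ∫ x, χ (‖x‖ • (e : E)) ∂μ = ∫ x : ({(0)}ᶜ : Set E), χ (‖x.1‖ • (e : E)) ∂(μ.comap (↑)) := by
          rw [integral_subtype_comap (measurableSet_singleton _).compl fun x : E ↦ χ (‖x‖ • (e : E)),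
            restrict_compl_singleton]
      _ = ∫ x : sphere (0 : E) 1 × Ioi (0 : ℝ), χ ((x.2 : ℝ) • (e : E)) ∂σ.prod τ := by
          rw [← hmp.integral_comp (Homeomorph.measurableEmbedding _)]
          simp only [homeomorphUnitSphereProd_apply_snd_coe]
      _ = _ := by
          have := integral_fun_snd (μ := σ) (ν := τ) (fun r : Ioi (0:ℝ) => χ ((r : ℝ) • (e : E)))
          simpa using this
  have e4 : ∫ x in ball (0 : E) R, Ψ x ∂μ = ∫ x, χ x ∂μ := by
    rw [hχ, integral_indicator measurableSet_ball]
  rw [e2, e3, e4, e1, integral_prod _ i1]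
  have hpos : 0 < σ.real univ := by
    rw [Measure.real, ENNReal.toReal_pos_iff]
    exact ⟨Measure.measure_univ_pos.2 hσ, measure_lt_top _ _⟩
  rw [average_eq, smul_eq_mul] at he
  have := mul_le_mul_of_nonneg_left he hpos.le
  rwa [← mul_assoc, mul_inv_cancel₀ hpos.ne', one_mul] at this

lemma exists_dir (hN : 1 ≤ N) {R : ℝ} (Ψ : EuclideanSpace ℝ (Fin N) → ℝ)
    (hΨ : IntegrableOn Ψ (ball 0 R)) :
    ∃ e : EuclideanSpace ℝ (Fin N), ‖e‖ = 1 ∧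
      ∫ x in ball (0 : EuclideanSpace ℝ (Fin N)) R, Ψ (‖x‖ • e) ≤ ∫ x in ball 0 R, Ψ x :=
  haveI := nontrivial_E hN
  exists_dir_aux volume Ψ hΨ

lemma radial_integral (hN : 1 ≤ N) : ∃ C > (0:ℝ), ∀ (h : ℝ → ℝ) (s : Set ℝ), MeasurableSet s →
    ∫ x in {x : EuclideanSpace ℝ (Fin N) | ‖x‖ ∈ s}, h ‖x‖ =
      C * ∫ y in Ioi (0:ℝ) ∩ s, y ^ (N - 1) * h y := by
  haveI := nontrivial_E hN
  set E := EuclideanSpace ℝ (Fin N)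
  have hdim : Module.finrank ℝ E = N := by simp [E]
  refine ⟨N * (volume : Measure E).real (ball 0 1), ?_, fun h s hs => ?_⟩
  · apply mul_pos
    · exact_mod_cast hN
    · rw [Measure.real, ENNReal.toReal_pos_iff]
      exact ⟨measure_ball_pos _ _ one_pos, measure_ball_lt_top⟩
  · have hs' : MeasurableSet {x : E | ‖x‖ ∈ s} := measurable_norm hs
    have := integral_fun_norm_addHaar (volume : Measure E) (s.indicator h)
    rw [← integral_indicator hs']
    have e1 : ({x : E | ‖x‖ ∈ s}.indicator fun x => h ‖x‖) = fun x => s.indicator h ‖x‖ := by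
      ext x; simp [indicator]
    rw [e1, this, hdim, nsmul_eq_mul, smul_eq_mul, mul_assoc, ← setIntegral_indicator hs]
    congr 3
    ext y
    by_cases hy : y ∈ s <;> simp [hy]

end


section
variable {N : ℕ}

lemma ball_ae_closedBall (hN : 1 ≤ N) (R : ℝ) :
    (ball (0 : EuclideanSpace ℝ (Fin N)) R : Set _) =ᵐ[volume] closedBall 0 R := by
  haveI := nontrivial_E hN
  rw [← ball_union_sphere]
  exact (union_ae_eq_left_of_ae_eq_empty (ae_eq_empty.2 (Measure.addHaar_sphere _ _ _))).symm

lemma rho_le {R s t : ℝ} (hs : s ∈ Ioo (0:ℝ) 1) (hR : 0 < R) (ht : t ∈ Icc 0 R) :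
    t ≤ √(s * R ^ 2 + (1 - s) * t ^ 2) ∧ √(s * R ^ 2 + (1 - s) * t ^ 2) ≤ R ∧
      0 < √(s * R ^ 2 + (1 - s) * t ^ 2) := by
  have h2 : t ^ 2 ≤ R ^ 2 := pow_le_pow_left₀ ht.1 ht.2 2
  have h1 := hs.1
  have h3 := hs.2
  have h4 : 0 < R ^ 2 := by positivity
  refine ⟨Real.le_sqrt_of_sq_le (by nlinarith), Real.sqrt_le_iff.2 ⟨hR.le, by nlinarith⟩,
    Real.sqrt_pos.2 (by nlinarith [sq_nonneg t])⟩

lemma radial_comp_s {R : ℝ} (hR : 0 < R) {g f : ℝ → ℝ} (hg : GCond g) (hf : Continuous f)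
    {u : EuclideanSpace ℝ (Fin N) → ℝ}
    {D : EuclideanSpace ℝ (Fin N) → (EuclideanSpace ℝ (Fin N) →L[ℝ] ℝ)}
    (hDc : ContinuousOn D (closedBall 0 R))
    (hD : ∀ x ∈ closedBall 0 R, HasFDerivWithinAt u (D x) (closedBall 0 R) x)
    (hu0 : ∀ x ∈ sphere (0 : EuclideanSpace ℝ (Fin N)) R, u x = 0)
    (hupos : ∀ x ∈ closedBall (0 : EuclideanSpace ℝ (Fin N)) R, 0 ≤ u x)
    (hmin : MinNN R g f u) {e : EuclideanSpace ℝ (Fin N)} (he : ‖e‖ = 1)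
    {s : ℝ} (hs : s ∈ Ioo (0:ℝ) 1) :
    ∫ x in ball 0 R, (Gh g ‖D x‖ - Gfun f (u x)) ≤
      ∫ x in ball (0 : EuclideanSpace ℝ (Fin N)) R,
        (fun r : ℝ => Gh g (D (r • e) e) - Gfun f (u (r • e)))
          (√(s * R ^ 2 + (1 - s) * ‖x‖ ^ 2)) := by
  have huc : ContinuousOn u (closedBall 0 R) := fun x hx => (hD x hx).continuousWithinAt
  set ρ : EuclideanSpace ℝ (Fin N) → ℝ := fun x => √(s * R ^ 2 + (1 - s) * ‖x‖ ^ 2) with hρ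
  have hρc : Continuous ρ := by fun_prop
  have hρ1 : ∀ x ∈ closedBall (0 : EuclideanSpace ℝ (Fin N)) R, ‖x‖ ≤ ρ x ∧ ρ x ≤ R ∧ 0 < ρ x := by
    intro x hx
    exact rho_le hs hR ⟨norm_nonneg _, by simpa using hx⟩
  have hmaps : MapsTo (fun x => ρ x • e) (closedBall 0 R) (closedBall 0 R) := by
    intro x hx
    have := hρ1 x hx
    simp [norm_smul, he, abs_of_pos this.2.2, this.2.1]
  set Dρ : EuclideanSpace ℝ (Fin N) → (EuclideanSpace ℝ (Fin N) →L[ℝ] ℝ) := fun x =>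
    ((1 - s) / ρ x) • innerSL ℝ x with hDρ
  have hρd : ∀ x ∈ closedBall (0 : EuclideanSpace ℝ (Fin N)) R, HasFDerivAt ρ (Dρ x) x := by
    intro x hx
    have h1 : HasFDerivAt (fun x : EuclideanSpace ℝ (Fin N) => s * R ^ 2 + (1 - s) * ‖x‖ ^ 2)
        ((1 - s) • (2 • innerSL ℝ x)) x :=
      (((hasStrictFDerivAt_norm_sq x).hasFDerivAt).const_mul (1 - s)).const_add _
    have h2 := h1.sqrt (Real.sqrt_pos.1 (hρ1 x hx).2.2).ne'
    refine h2.congr_fderiv ?_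
    ext y
    have := (hρ1 x hx).2.2.ne'
    simp [hDρ]
    change (ρ x)⁻¹ * _ * _ = _
    field_simp
  have hDρn : ∀ x ∈ closedBall (0 : EuclideanSpace ℝ (Fin N)) R, ‖Dρ x‖ ≤ 1 := by
    intro x hx
    obtain ⟨h1, h2, h3⟩ := hρ1 x hx
    have h4 := hs.1
    have h5 := hs.2
    rw [hDρ, norm_smul, innerSL_apply_norm, Real.norm_eq_abs,
      abs_of_nonneg (div_nonneg (by linarith) h3.le), div_mul_eq_mul_div, div_le_one h3]
    nlinarith [norm_nonneg x]
  set v : EuclideanSpace ℝ (Fin N) → ℝ := fun x => u (ρ x • e) with hv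
  set Dv : EuclideanSpace ℝ (Fin N) → (EuclideanSpace ℝ (Fin N) →L[ℝ] ℝ) := fun x =>
    (D (ρ x • e) e) • Dρ x with hDv
  have hDcomp : ContinuousOn (fun x => D (ρ x • e)) (closedBall 0 R) :=
    hDc.comp (by fun_prop) hmaps
  have hDvc : ContinuousOn Dv (closedBall 0 R) := by
    have h1 : ContinuousOn (fun x => D (ρ x • e) e) (closedBall 0 R) :=
      hDcomp.clm_apply continuousOn_const
    have h2 : ContinuousOn (fun x => (1 - s) / ρ x) (closedBall 0 R) :=
      continuousOn_const.div hρc.continuousOn fun x hx => (hρ1 x hx).2.2.ne'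
    exact h1.smul (h2.smul (innerSL ℝ).continuous.continuousOn)
  have hvd : ∀ x ∈ closedBall 0 R, HasFDerivWithinAt v (Dv x) (closedBall 0 R) x := by
    intro x hx
    have h1 := (hρd x hx).smul_const e
    have h2 := (hD _ (hmaps hx)).comp x h1.hasFDerivWithinAt hmaps
    refine h2.congr_fderiv ?_
    ext y
    simp [hDv, mul_comm]
  have key := hmin v (contDiffOn_of hR hDvc hvd) (by
    intro x hx
    apply hu0
    have hx' : ‖x‖ = R := by simpa using hx
    have := hρ1 x (sphere_subset_closedBall hx)
    have : ρ x = R := le_antisymm this.2.1 (hx' ▸ this.1)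
    simp [norm_smul, he, this, abs_of_pos hR]) (fun x hx => hupos _ (hmaps hx))
  rw [J_eq hD, J_eq hvd] at key
  refine key.trans ?_
  have hvc : ContinuousOn v (closedBall 0 R) := huc.comp (by fun_prop) hmaps
  apply setIntegral_mono_on (J_integrable hg hf hDvc hvc) _ measurableSet_ball
  · intro x hx
    have hx' := ball_subset_closedBall hx
    have : Gh g ‖Dv x‖ ≤ Gh g (D (ρ x • e) e) := by
      rw [← Gh_abs hg (D (ρ x • e) e)]
      apply (Gh_strictMonoOn hg).monotoneOn (mem_Ici.2 (norm_nonneg _)) (mem_Ici.2 (abs_nonneg _))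
      rw [hDv, norm_smul, Real.norm_eq_abs]
      exact mul_le_of_le_one_right (abs_nonneg _) (hDρn x hx')
    simp only
    linarith
  · have : ContinuousOn (fun x => Gh g (D (ρ x • e) e) - Gfun f (v x)) (closedBall 0 R) :=
      ((Gh_continuous hg).comp_continuousOn (hDcomp.clm_apply continuousOn_const)).sub
        ((Gfun_continuous hf).comp_continuousOn hvc)
    exact (this.integrableOn_compact (isCompact_closedBall _ _)).mono_set ball_subset_closedBall

lemma ray_maps {R : ℝ} {e : EuclideanSpace ℝ (Fin N)} (he : ‖e‖ = 1) :
    MapsTo (fun r : ℝ => r • e) (Icc 0 R) (closedBall 0 R) := by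
  intro r hr
  simp [norm_smul, he, abs_of_nonneg hr.1, hr.2]

lemma radial_comp (hN : 1 ≤ N) {R : ℝ} (hR : 0 < R) {g f : ℝ → ℝ} (hg : GCond g) (hf : Continuous f)
    {u : EuclideanSpace ℝ (Fin N) → ℝ}
    {D : EuclideanSpace ℝ (Fin N) → (EuclideanSpace ℝ (Fin N) →L[ℝ] ℝ)}
    (hDc : ContinuousOn D (closedBall 0 R))
    (hD : ∀ x ∈ closedBall 0 R, HasFDerivWithinAt u (D x) (closedBall 0 R) x)
    (hu0 : ∀ x ∈ sphere (0 : EuclideanSpace ℝ (Fin N)) R, u x = 0)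
    (hupos : ∀ x ∈ closedBall (0 : EuclideanSpace ℝ (Fin N)) R, 0 ≤ u x)
    (hmin : MinNN R g f u) {e : EuclideanSpace ℝ (Fin N)} (he : ‖e‖ = 1) :
    ∫ x in ball 0 R, (Gh g ‖D x‖ - Gfun f (u x)) ≤
      ∫ x in ball (0 : EuclideanSpace ℝ (Fin N)) R, 
        (Gh g (D (‖x‖ • e) e) - Gfun f (u (‖x‖ • e))) := by
  have huc : ContinuousOn u (closedBall 0 R) := fun x hx => (hD x hx).continuousWithinAt
  set Φ : ℝ → ℝ := fun r => Gh g (D (r • e) e) - Gfun f (u (r • e)) with hΦ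
  have hΦc : ContinuousOn Φ (Icc 0 R) :=
    ((Gh_continuous hg).comp_continuousOn ((hDc.comp (by fun_prop) (ray_maps he)).clm_apply
      continuousOn_const)).sub
        ((Gfun_continuous hf).comp_continuousOn (huc.comp (by fun_prop) (ray_maps he)))
  set Ψ : ℝ → ℝ := fun r => Φ (max 0 (min r R)) with hΨ
  have hΨc : Continuous Ψ := by
    apply hΦc.comp_continuous (by fun_prop)
    intro x
    exact ⟨le_max_left _ _, max_le hR.le (min_le_right _ _)⟩
  have hΨe : ∀ r ∈ Icc 0 R, Ψ r = Φ r := by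
    intro r hr
    simp [hΨ, hr.1, hr.2]
  have hcont : Continuous fun s : ℝ => ∫ x in closedBall (0 : EuclideanSpace ℝ (Fin N)) R,
      Ψ (√(s * R ^ 2 + (1 - s) * ‖x‖ ^ 2)) := by
    apply continuous_parametric_integral_of_continuous _ (isCompact_closedBall _ _)
    simp only [Function.uncurry_def]
    fun_prop
  have h0 := (hcont.tendsto 0).mono_left (nhdsWithin_le_nhds (s := Ioi 0))
  have e0 : ∫ x in closedBall (0 : EuclideanSpace ℝ (Fin N)) R,
      Ψ (√(0 * R ^ 2 + (1 - 0) * ‖x‖ ^ 2)) = ∫ x in ball (0 : EuclideanSpace ℝ (Fin N)) R, Φ ‖x‖ := by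
    rw [← setIntegral_congr_set (ball_ae_closedBall hN R)]
    apply setIntegral_congr_fun measurableSet_ball
    intro x hx
    simp only [zero_mul, sub_zero, one_mul, zero_add, Real.sqrt_sq (norm_nonneg x)]
    apply hΨe
    exact ⟨norm_nonneg _, by simpa using (ball_subset_closedBall hx)⟩
  rw [e0] at h0
  apply ge_of_tendsto h0
  filter_upwards [Ioo_mem_nhdsGT (zero_lt_one' ℝ)] with s hs
  refine (radial_comp_s hR hg hf hDc hD hu0 hupos hmin he hs).trans (le_of_eq ?_)
  rw [← setIntegral_congr_set (ball_ae_closedBall hN R)]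
  apply setIntegral_congr_fun measurableSet_ball
  intro x hx
  have := rho_le hs hR (t := ‖x‖) ⟨norm_nonneg _, by simpa using (ball_subset_closedBall hx)⟩
  exact (hΨe _ ⟨this.2.2.le, this.2.1⟩).symm

end


section
variable {N : ℕ}

lemma norm_unit {x : EuclideanSpace ℝ (Fin N)} (hx : x ≠ 0) : ‖(‖x‖⁻¹ • x)‖ = 1 := by
  rw [norm_smul, norm_inv, norm_norm, inv_mul_cancel₀ (norm_ne_zero_iff.2 hx)]

lemma radial_norm (hN : 1 ≤ N) {R : ℝ} (hR : 0 < R) {g f : ℝ → ℝ} (hg : GCond g) (hf : Continuous f)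
    {u : EuclideanSpace ℝ (Fin N) → ℝ}
    {D : EuclideanSpace ℝ (Fin N) → (EuclideanSpace ℝ (Fin N) →L[ℝ] ℝ)}
    (hDc : ContinuousOn D (closedBall 0 R))
    (hD : ∀ x ∈ closedBall 0 R, HasFDerivWithinAt u (D x) (closedBall 0 R) x)
    (hu0 : ∀ x ∈ sphere (0 : EuclideanSpace ℝ (Fin N)) R, u x = 0)
    (hupos : ∀ x ∈ closedBall (0 : EuclideanSpace ℝ (Fin N)) R, 0 ≤ u x)
    (hmin : MinNN R g f u) {x : EuclideanSpace ℝ (Fin N)} (hx : x ∈ ball 0 R) (hx0 : x ≠ 0) :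
    ‖D x‖ = |D x (‖x‖⁻¹ • x)| := by
  haveI := nontrivial_E hN
  have huc : ContinuousOn u (closedBall 0 R) := fun x hx => (hD x hx).continuousWithinAt
  set S : Set (EuclideanSpace ℝ (Fin N)) := ball 0 R ∩ {0}ᶜ with hS
  have hSo : IsOpen S := isOpen_ball.inter isOpen_compl_singleton
  have hSae : S =ᵐ[volume] ball 0 R := by
    rw [hS, ← diff_eq]
    exact diff_null_ae_eq_self (measure_singleton _)
  have hSsub : S ⊆ closedBall 0 R := inter_subset_left.trans ball_subset_closedBall
  set k : EuclideanSpace ℝ (Fin N) → ℝ := fun x => Gh g (D x (‖x‖⁻¹ • x)) with hk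
  have hkc : ContinuousOn k S := by
    apply (Gh_continuous hg).comp_continuousOn
    apply (hDc.mono hSsub).clm_apply
    have h1 : ContinuousOn (fun x : EuclideanSpace ℝ (Fin N) => ‖x‖⁻¹) S :=
      continuous_norm.continuousOn.inv₀ fun x hx => norm_ne_zero_iff.2 hx.2
    exact h1.smul continuousOn_id
  have hnc : ContinuousOn (fun x => Gh g ‖D x‖) (closedBall 0 R) :=
    (Gh_continuous hg).comp_continuousOn hDc.norm
  have hni : IntegrableOn (fun x => Gh g ‖D x‖) (ball 0 R) :=
    (hnc.integrableOn_compact (isCompact_closedBall _ _)).mono_set ball_subset_closedBall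
  have hFc : ContinuousOn (fun x => Gfun f (u x)) (closedBall 0 R) :=
    (Gfun_continuous hf).comp_continuousOn huc
  have hFi : IntegrableOn (fun x => Gfun f (u x)) (ball 0 R) :=
    (hFc.integrableOn_compact (isCompact_closedBall _ _)).mono_set ball_subset_closedBall
  have hle : ∀ x, k x ≤ Gh g ‖D x‖ := by
    intro x
    rw [hk]; simp only
    rw [← Gh_abs hg]
    apply (Gh_strictMonoOn hg).monotoneOn (mem_Ici.2 (abs_nonneg _)) (mem_Ici.2 (norm_nonneg _))
    by_cases h0 : x = 0
    · simp [h0]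
    · simpa [norm_unit h0] using (D x).le_opNorm (‖x‖⁻¹ • x)
  have hk0 : ∀ x, 0 ≤ k x := by
    intro x
    rw [hk]; simp only
    rw [← Gh_abs hg, ← Gh_zero g]
    exact (Gh_strictMonoOn hg).monotoneOn (mem_Ici.2 le_rfl) (mem_Ici.2 (abs_nonneg _)) (abs_nonneg _)
  have hki : IntegrableOn k (ball 0 R) := by
    apply Integrable.mono' hni
    · rw [← Measure.restrict_congr_set hSae]
      exact hkc.aestronglyMeasurable hSo.measurableSet
    · refine Filter.Eventually.of_forall fun x => ?_
      rw [Real.norm_eq_abs, abs_of_nonneg (hk0 x)]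
      exact hle x
  obtain ⟨e, he, hle2⟩ := exists_dir hN (fun x => k x - Gfun f (u x)) (hki.sub hFi)
  have h1 := radial_comp hN hR hg hf hDc hD hu0 hupos hmin he
  have h2 : ∫ x in ball (0 : EuclideanSpace ℝ (Fin N)) R, (Gh g (D (‖x‖ • e) e) - Gfun f (u (‖x‖ • e)))
      = ∫ x in ball (0 : EuclideanSpace ℝ (Fin N)) R, (k (‖x‖ • e) - Gfun f (u (‖x‖ • e))) := by
    rw [← setIntegral_congr_set hSae, ← setIntegral_congr_set hSae]
    apply setIntegral_congr_fun hSo.measurableSet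
    intro x hx
    have hx0 : ‖x‖ ≠ 0 := norm_ne_zero_iff.2 hx.2
    simp only [hk, norm_smul, he, norm_norm, mul_one, smul_smul, inv_mul_cancel₀ hx0, one_smul]
  have h3 := (h1.trans h2.le).trans hle2
  rw [integral_sub hni hFi, integral_sub hki hFi] at h3
  have h4 : ∫ x in ball (0 : EuclideanSpace ℝ (Fin N)) R, (Gh g ‖D x‖ - k x) = 0 := by
    apply le_antisymm
    · rw [integral_sub hni hki]; linarith
    · exact integral_nonneg fun x => sub_nonneg.2 (hle x)
  rw [integral_eq_zero_iff_of_nonneg (fun x => sub_nonneg.2 (hle x)) (hni.sub hki)] at h4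
  rw [← Measure.restrict_congr_set hSae] at h4
  have h5 := Measure.eqOn_open_of_ae_eq h4 hSo ((hnc.mono hSsub).sub hkc) continuousOn_const
  have h6 : Gh g ‖D x‖ - k x = 0 := h5 ⟨hx, hx0⟩
  apply (Gh_strictMonoOn hg).injOn (mem_Ici.2 (norm_nonneg _)) (mem_Ici.2 (abs_nonneg _))
  rw [Gh_abs hg]
  simp only [hk] at h6
  linarith

/-- a functional whose norm is attained at a unit vector `a` is determined by it -/
lemma clm_eq_of_norm {L : EuclideanSpace ℝ (Fin N) →L[ℝ] ℝ} {a : EuclideanSpace ℝ (Fin N)}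
    (ha : ‖a‖ = 1) (h : ‖L‖ = |L a|) (y : EuclideanSpace ℝ (Fin N)) : L y = L a * ⟪a, y⟫ := by
  obtain ⟨v, rfl⟩ := (InnerProductSpace.toDual ℝ (EuclideanSpace ℝ (Fin N))).surjective L
  simp only [InnerProductSpace.toDual_apply_apply, LinearIsometryEquiv.norm_map] at h ⊢
  have hv : v = ⟪v, a⟫ • a := by
    rw [← sub_eq_zero, ← norm_eq_zero, ← sq_eq_zero_iff, norm_sub_sq_real, norm_smul, ha, h,
      Real.norm_eq_abs, inner_smul_right]
    simp only [sq_abs, mul_one]; ring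
  conv_lhs => rw [hv]
  rw [inner_smul_left]; simp

lemma sphere_const (hN : 2 ≤ N) {R : ℝ} (hR : 0 < R) {u : EuclideanSpace ℝ (Fin N) → ℝ}
    {D : EuclideanSpace ℝ (Fin N) → (EuclideanSpace ℝ (Fin N) →L[ℝ] ℝ)}
    (hD : ∀ x ∈ closedBall 0 R, HasFDerivWithinAt u (D x) (closedBall 0 R) x)
    (hu0 : ∀ x ∈ sphere (0 : EuclideanSpace ℝ (Fin N)) R, u x = 0)
    (hn : ∀ x ∈ ball (0 : EuclideanSpace ℝ (Fin N)) R, x ≠ 0 → ‖D x‖ = |D x (‖x‖⁻¹ • x)|)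
    {a e : EuclideanSpace ℝ (Fin N)} (ha : ‖a‖ = 1) (he : ‖e‖ = 1) {r : ℝ} (hr : r ∈ Icc 0 R) :
    u (r • e) = u (r • a) := by
  rcases eq_or_lt_of_le hr.2 with rfl | hrR
  · rw [hu0, hu0] <;> simp [norm_smul, ha, he, abs_of_pos hR]
  rcases eq_or_lt_of_le hr.1 with rfl | hr0
  · simp
  -- the orthogonal direction
  obtain ⟨b, hb, hab, θ, hθ⟩ : ∃ b : EuclideanSpace ℝ (Fin N), ‖b‖ = 1 ∧ ⟪a, b⟫ = 0 ∧
      ∃ θ : ℝ, e = Real.cos θ • a + Real.sin θ • b := by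
    by_cases hc : e - ⟪a, e⟫ • a = 0
    · obtain ⟨b, hb, hab⟩ : ∃ b : EuclideanSpace ℝ (Fin N), ‖b‖ = 1 ∧ ⟪a, b⟫ = 0 := by
        have hne : (ℝ ∙ a)ᗮ ≠ ⊥ := by
          intro h
          have h1 := Submodule.orthogonal_eq_bot_iff.1 h
          have h2 := finrank_span_le_card (R := ℝ) ({a} : Set (EuclideanSpace ℝ (Fin N)))
          rw [h1] at h2
          simp at h2
          omega
        obtain ⟨b, hb, hb0⟩ := Submodule.exists_mem_ne_zero_of_ne_bot hne
        refine ⟨‖b‖⁻¹ • b, norm_unit hb0, ?_⟩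
        rw [inner_smul_right, Submodule.mem_orthogonal_singleton_iff_inner_right.1 hb, mul_zero]
      have h1 : e = ⟪a, e⟫ • a := sub_eq_zero.1 hc
      have h2 : |⟪a, e⟫| = 1 := by
        have := congrArg norm h1
        rw [norm_smul, ha, he, Real.norm_eq_abs, mul_one] at this
        exact this.symm
      refine ⟨b, hb, hab, ?_⟩
      rcases (abs_eq zero_le_one).1 h2 with h3 | h3
      · exact ⟨0, by rw [h3] at h1; simpa using h1⟩
      · exact ⟨Real.pi, by rw [h3] at h1; simpa using h1⟩
    · set c := e - ⟪a, e⟫ • a with hcdef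
      have hcn : ‖c‖ ^ 2 = 1 - ⟪a, e⟫ ^ 2 := by
        rw [hcdef, norm_sub_sq_real, norm_smul, ha, he, inner_smul_right, real_inner_comm,
          Real.norm_eq_abs, mul_one, sq_abs, real_inner_comm]
        ring
      have hac : ⟪a, c⟫ = 0 := by
        rw [hcdef, inner_sub_right, inner_smul_right, real_inner_self_eq_norm_sq, ha]; ring
      have habs := abs_le.1 (abs_real_inner_le_norm a e)
      rw [ha, he, mul_one] at habs
      refine ⟨‖c‖⁻¹ • c, norm_unit hc, by rw [inner_smul_right, hac, mul_zero],
        Real.arccos ⟪a, e⟫, ?_⟩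
      rw [Real.cos_arccos habs.1 habs.2, Real.sin_arccos, ← hcn, Real.sqrt_sq (norm_nonneg _),
        smul_smul, mul_inv_cancel₀ (norm_ne_zero_iff.2 hc), one_smul, hcdef]
      abel
  set γ : ℝ → EuclideanSpace ℝ (Fin N) := fun t => r • (Real.cos t • a + Real.sin t • b) with hγ
  have hγn : ∀ t, ‖γ t‖ = r := by
    intro t
    have h2 : ‖Real.cos t • a + Real.sin t • b‖ ^ 2 = 1 := by
      rw [norm_add_sq_real, norm_smul, norm_smul, ha, hb, inner_smul_left, inner_smul_right, hab]
      simp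
    have h3 : ‖Real.cos t • a + Real.sin t • b‖ = 1 := by
      exact (pow_eq_one_iff_of_nonneg (norm_nonneg _) two_ne_zero).1 h2
    rw [hγ]; simp only; rw [norm_smul, h3, mul_one, Real.norm_eq_abs, abs_of_pos hr0]
  have hγd : ∀ t, HasDerivAt γ (r • (-Real.sin t • a + Real.cos t • b)) t := fun t =>
    (((Real.hasDerivAt_cos t).smul_const a).add ((Real.hasDerivAt_sin t).smul_const b)).const_smul r
  have hd : ∀ t, HasDerivAt (u ∘ γ) 0 t := by
    intro t
    have hm : γ t ∈ ball 0 R := by simp [hγn t, hrR]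
    have hne : γ t ≠ 0 := by rw [← norm_ne_zero_iff, hγn]; exact hr0.ne'
    have h1 := (hasFDerivAt_of_within hm (hD _ (ball_subset_closedBall hm))).comp_hasDerivAt t (hγd t)
    refine h1.congr_deriv ?_
    rw [clm_eq_of_norm (norm_unit hne) (hn _ hm hne)]
    have : ⟪γ t, r • (-Real.sin t • a + Real.cos t • b)⟫ = 0 := by
      simp only [hγ, inner_smul_left, inner_smul_right, inner_add_left, inner_add_right, hab,
        real_inner_self_eq_norm_sq, ha, hb, real_inner_comm a b]
      simp
      ring_nf
      simp
    rw [inner_smul_left, this]; simp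
  have hconst := is_const_of_deriv_eq_zero (fun t => (hd t).differentiableAt) (fun t => (hd t).deriv) θ 0
  have e1 : γ θ = r • e := by rw [hγ, hθ]
  have e2 : γ 0 = r • a := by simp [hγ]
  rw [← e1, ← e2]; exact hconst

end


lemma zero_of_int {a b : ℝ} {h : ℝ → ℝ} (hc : ContinuousOn h (Icc a b)) (h0 : ∀ x ∈ Icc a b, 0 ≤ h x)
    (hi : ∫ x in Ioo a b, h x ≤ 0) : ∀ x ∈ Ioo a b, h x = 0 := by
  have hInt : IntegrableOn h (Ioo a b) :=
    (hc.integrableOn_compact isCompact_Icc).mono_set Ioo_subset_Icc_self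
  have hae : ∀ᵐ x ∂(volume.restrict (Ioo a b)), 0 ≤ h x :=
    (ae_restrict_iff' measurableSet_Ioo).2 (Filter.Eventually.of_forall fun x hx =>
      h0 x (Ioo_subset_Icc_self hx))
  have h1 : ∫ x in Ioo a b, h x = 0 := le_antisymm hi (integral_nonneg_of_ae hae)
  rw [integral_eq_zero_iff_of_nonneg_ae hae hInt] at h1
  exact Measure.eqOn_open_of_ae_eq h1 isOpen_Ioo (hc.mono Ioo_subset_Icc_self) continuousOn_const

lemma C1On.hasDerivAt {U U' : ℝ → ℝ} {a b r : ℝ} (h : C1On U U' a b) (hr : r ∈ Ioo a b) :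
    HasDerivAt U (U' r) r :=
  (h.2 r (Ioo_subset_Icc_self hr)).hasDerivAt (Icc_mem_nhds hr.1 hr.2)

lemma C1On.cont {U U' : ℝ → ℝ} {a b : ℝ} (h : C1On U U' a b) : ContinuousOn U (Icc a b) :=
  fun r hr => (h.2 r hr).continuousWithinAt

lemma Hh_continuous {g : ℝ → ℝ} (hg : GCond g) : Continuous (Hh g) :=
  (continuous_id.mul (gh_continuous hg)).sub (Gh_continuous hg)

lemma ode_radial {R : ℝ} {g f : ℝ → ℝ} (hg : GCond g) (hf : Continuous f) (n : ℕ)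
    {U U' : ℝ → ℝ} (hU : C1On U U' 0 R)
    (hode : ∀ r ∈ Ioo 0 R, HasDerivAt (fun r => r ^ n * gh g (U' r)) (-(r ^ n * f (U r))) r)
    {r1 : ℝ} (hr1 : r1 ∈ Ioc 0 R) (hcr : U' r1 = 0)
    (hv : ∫ y in Ioo 0 r1, y ^ n * (Gh g (U' y) - Gfun f (U y) + Gfun f (U r1)) ≤ 0) :
    ∀ r ∈ Ioo 0 r1, U' r = 0 := by
  have hsub : Icc 0 r1 ⊆ Icc 0 R := Icc_subset_Icc_right hr1.2
  set E : ℝ → ℝ := fun y => Hh g (U' y) + Gfun f (U y) with hE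
  set P : ℝ → ℝ := fun y => U' y * gh g (U' y) with hP
  have hEc : ContinuousOn E (Icc 0 R) :=
    ((Hh_continuous hg).comp_continuousOn hU.1).add ((Gfun_continuous hf).comp_continuousOn hU.cont)
  have hPc : ContinuousOn P (Icc 0 R) := hU.1.mul ((gh_continuous hg).comp_continuousOn hU.1)
  have hEd : ∀ r ∈ Ioo 0 R, HasDerivAt E (-(n * P r / r)) r := by
    intro r hr
    have hr0 : r ≠ 0 := hr.1.ne'
    have h1 := hode r hr
    have h2 : HasDerivAt (fun s : ℝ => (s ^ n)⁻¹) (-(n * r ^ (n - 1)) / (r ^ n) ^ 2) r :=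
      (hasDerivAt_pow n r).inv (pow_ne_zero _ hr0)
    have h3 : HasDerivAt (fun s => gh g (U' s)) (-f (U r) - n * gh g (U' r) / r) r := by
      have h4 := (h2.mul h1)
      have h5 : (fun s => gh g (U' s)) =ᶠ[nhds r] (fun s : ℝ => (s ^ n)⁻¹ * (s ^ n * gh g (U' s))) := by
        filter_upwards [lt_mem_nhds hr.1] with s hs
        have : s ^ n ≠ 0 := pow_ne_zero _ (ne_of_gt hs)
        field_simp
      refine (h4.congr_of_eventuallyEq h5).congr_deriv ?_
      rcases n with _ | n
      · simp
      · have : r ^ n ≠ 0 := pow_ne_zero _ hr0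
        simp only [Nat.add_sub_cancel]
        push_cast
        field_simp
        ring
    have h6 := energy_hasDerivAt hg (hU.1.continuousAt (Icc_mem_nhds hr.1 hr.2)) h3
    have h7 := (Gfun_hasDerivAt hf (U r)).comp r (hU.hasDerivAt hr)
    refine (h6.add h7).congr_deriv ?_
    simp only [hP]; field_simp; ring
  have hE1 : E r1 = Gfun f (U r1) := by simp [hE, hcr, Hh_zero]
  set Q' : ℝ → ℝ := fun y => (n + 1) * y ^ n * (E y - E r1) - n * y ^ n * P y with hQ'
  have hQd : ∀ y ∈ Ioo 0 r1, HasDerivAt (fun y => y ^ (n + 1) * (E y - E r1)) (Q' y) y := by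
    intro y hy
    have hy0 : y ≠ 0 := hy.1.ne'
    refine ((hasDerivAt_pow (n + 1) y).mul ((hEd y ⟨hy.1, hy.2.trans_le hr1.2⟩).sub_const
      (E r1))).congr_deriv ?_
    simp only [hQ', Nat.add_sub_cancel]
    push_cast
    field_simp
    ring
  have hEc' := hEc.mono hsub
  have hPc' := hPc.mono hsub
  have hQc : ContinuousOn Q' (Icc 0 r1) := by
    simp only [hQ']; fun_prop
  have hFTC := intervalIntegral.integral_eq_sub_of_hasDerivAt_of_le hr1.1.le
    (f := fun y => y ^ (n + 1) * (E y - E r1)) (f' := Q') (by fun_prop) hQd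
    (hQc.intervalIntegrable_of_Icc hr1.1.le)
  simp only [sub_self, mul_zero, ne_eq, Nat.add_eq_zero_iff, one_ne_zero, and_false,
    not_false_eq_true, zero_pow, zero_mul] at hFTC
  rw [intervalIntegral.integral_of_le hr1.1.le, integral_Ioc_eq_integral_Ioo] at hFTC
  have hQi : IntegrableOn Q' (Ioo 0 r1) :=
    (hQc.integrableOn_compact isCompact_Icc).mono_set Ioo_subset_Icc_self
  have hPi : ContinuousOn (fun y => y ^ n * P y) (Icc 0 r1) := by fun_prop
  have hPi' : IntegrableOn (fun y => y ^ n * P y) (Ioo 0 r1) :=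
    (hPi.integrableOn_compact isCompact_Icc).mono_set Ioo_subset_Icc_self
  have key : (n + 1 : ℝ) * ∫ y in Ioo 0 r1, y ^ n * (Gh g (U' y) - Gfun f (U y) + Gfun f (U r1))
      = ∫ y in Ioo 0 r1, y ^ n * P y := by
    have : ∫ y in Ioo 0 r1, (y ^ n * P y - Q' y) = ∫ y in Ioo 0 r1, y ^ n * P y := by
      rw [integral_sub hPi' hQi, hFTC, sub_zero]
    rw [← this, ← integral_const_mul]
    congr 1
    ext y
    rw [← hE1]
    simp only [hQ', hP, hE, Hh]
    ring
  have hle : ∫ y in Ioo 0 r1, y ^ n * P y ≤ 0 := by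
    rw [← key]; exact mul_nonpos_of_nonneg_of_nonpos (by positivity) hv
  intro r hr
  have := zero_of_int hPi (fun y hy => mul_nonneg (pow_nonneg hy.1 _) (mul_gh_nonneg hg _)) hle r hr
  rcases mul_eq_zero.1 this with h | h
  · exact absurd h (pow_ne_zero _ hr.1.ne')
  · exact mul_gh_eq_zero hg h

lemma const_of_zero {U U' : ℝ → ℝ} {a b R : ℝ} (hU : C1On U U' a R) (hb : b ≤ R)
    (h0 : ∀ r ∈ Ioo a b, U' r = 0) : ∀ r ∈ Icc a b, U r = U a := by
  intro r hr
  have hanti : ∀ x ∈ interior (Icc a b), deriv U x = 0 := by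
    intro x hx
    rw [interior_Icc] at hx
    rw [(hU.hasDerivAt ⟨hx.1, hx.2.trans_le hb⟩).deriv, h0 x hx]
  have hc : ContinuousOn U (Icc a b) := hU.cont.mono (Icc_subset_Icc_right hb)
  have hd : DifferentiableOn ℝ U (interior (Icc a b)) := by
    intro x hx
    rw [interior_Icc] at hx
    exact (hU.hasDerivAt ⟨hx.1, hx.2.trans_le hb⟩).differentiableAt.differentiableWithinAt
  have ha : a ∈ Icc a b := ⟨le_rfl, hr.1.trans hr.2⟩
  apply le_antisymm
  · exact antitoneOn_of_deriv_nonpos (convex_Icc a b) hc hd (fun x hx => (hanti x hx).le) ha hr hr.1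
  · exact monotoneOn_of_deriv_nonneg (convex_Icc a b) hc hd (fun x hx => (hanti x hx).ge) ha hr hr.1

/-- sign of the derivative after the last critical point -/
lemma sign_right {U U' : ℝ → ℝ} {a R : ℝ} (hU : C1On U U' a R)
    (hpos : ∀ r ∈ Icc a R, 0 ≤ U r) (hUR : U R = 0)
    (hne : ∀ r ∈ Ioc a R, U' r ≠ 0) : ∀ r ∈ Ioc a R, U' r < 0 := by
  intro x hx
  by_contra hcon
  have hxp : 0 < U' x := lt_of_le_of_ne (not_lt.1 hcon) (hne x hx).symm
  have hall : ∀ y ∈ Icc x R, 0 < U' y := by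
    intro y hy
    by_contra hy'
    have hc : ContinuousOn U' (Icc x y) := hU.1.mono (Icc_subset_Icc hx.1.le hy.2)
    obtain ⟨z, hz, hz0⟩ := intermediate_value_Icc' hy.1 hc ⟨not_lt.1 hy', hxp.le⟩
    exact hne z ⟨hx.1.trans_le hz.1, hz.2.trans hy.2⟩ hz0
  have hRR : 0 < U' R := hall R ⟨hx.2, le_rfl⟩
  -- strict monotone on [x', R] with x' < R
  have hxR : ∃ x', a < x' ∧ x' < R ∧ ∀ y ∈ Icc x' R, 0 < U' y := by
    rcases eq_or_lt_of_le hx.2 with h | h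
    · have haR : a < R := h ▸ hx.1
      refine ⟨(a + R) / 2, by linarith, by linarith, fun y hy => ?_⟩
      by_contra hy'
      have hc : ContinuousOn U' (Icc y R) := hU.1.mono (Icc_subset_Icc (by linarith [hy.1]) le_rfl)
      obtain ⟨z, hz, hz0⟩ := intermediate_value_Icc hy.2 hc ⟨not_lt.1 hy', hRR.le⟩
      exact hne z ⟨by linarith [hy.1, hz.1], hz.2⟩ hz0
    · exact ⟨x, hx.1, h, hall⟩
  obtain ⟨x', h1, h2, h3⟩ := hxR
  have hsm : StrictMonoOn U (Icc x' R) := by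
    apply strictMonoOn_of_deriv_pos (convex_Icc _ _) (hU.cont.mono (Icc_subset_Icc_left h1.le))
    intro y hy
    rw [interior_Icc] at hy
    rw [(hU.hasDerivAt ⟨h1.trans hy.1, hy.2⟩).deriv]
    exact h3 y (Ioo_subset_Icc_self hy)
  have := hsm ⟨le_rfl, h2.le⟩ ⟨h2.le, le_rfl⟩ h2
  linarith [hpos x' ⟨h1.le, h2.le⟩]

lemma profile {R : ℝ} (hR : 0 < R) {U U' : ℝ → ℝ} (hU : C1On U U' 0 R)
    (hpos : ∀ r ∈ Icc 0 R, 0 ≤ U r) (hUR : U R = 0) (hnz : ∃ r ∈ Icc 0 R, U r ≠ 0) (h0 : U' 0 = 0)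
    (hcrit : ∀ r1 ∈ Ioc 0 R, U' r1 = 0 → ∀ r ∈ Ioo 0 r1, U' r = 0) :
    (∀ r ∈ Ico 0 R, 0 < U r) ∧ AntitoneOn U (Icc 0 R) ∧
    ∃ R' ∈ Ico (0:ℝ) R, (∀ r ∈ Ioo R' R, U' r < 0) ∧ ∀ r ∈ Icc (0:ℝ) R', U r = U 0 := by
  set K : Set ℝ := Icc 0 R ∩ U' ⁻¹' {0} with hK
  have hKc : IsCompact K := by
    apply isCompact_Icc.of_isClosed_subset _ inter_subset_left
    exact hU.1.preimage_isClosed_of_isClosed isClosed_Icc isClosed_singleton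
  have hKn : K.Nonempty := ⟨0, ⟨le_rfl, hR.le⟩, h0⟩
  obtain ⟨R', hR'K, hR'max⟩ := hKc.exists_isGreatest hKn
  have hR'0 : U' R' = 0 := hR'K.2
  have hz : ∀ r ∈ Ioo 0 R', U' r = 0 := by
    intro r hr
    exact hcrit R' ⟨hr.1.trans hr.2, hR'K.1.2⟩ hR'0 r hr
  have hconst := const_of_zero hU hR'K.1.2 hz
  have hR'R : R' < R := by
    rcases eq_or_lt_of_le hR'K.1.2 with h | h
    · exfalso
      obtain ⟨r, hr, hr0⟩ := hnz
      apply hr0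
      rw [h] at hconst
      rw [hconst r hr, ← hconst R ⟨hR.le, le_rfl⟩, hUR]
    · exact h
  have hsub : Icc R' R ⊆ Icc 0 R := Icc_subset_Icc_left hR'K.1.1
  have hU2 : C1On U U' R' R := ⟨hU.1.mono hsub, fun r hr => (hU.2 r (hsub hr)).mono hsub⟩
  have hneg := sign_right hU2 (fun r hr => hpos r (hsub hr)) hUR (by
    intro r hr h
    have := hR'max ⟨⟨hR'K.1.1.trans hr.1.le, hr.2⟩, h⟩
    linarith [hr.1])
  have hanti : AntitoneOn U (Icc 0 R) := by
    apply antitoneOn_of_deriv_nonpos (convex_Icc _ _) hU.cont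
    · intro x hx
      rw [interior_Icc] at hx
      exact (hU.hasDerivAt hx).differentiableAt.differentiableWithinAt
    · intro x hx
      rw [interior_Icc] at hx
      rw [(hU.hasDerivAt hx).deriv]
      rcases lt_trichotomy x R' with h | h | h
      · exact (hz x ⟨hx.1, h⟩).le
      · rw [h, hR'0]
      · exact (hneg x ⟨h, hx.2.le⟩).le
  have hsa : StrictAntiOn U (Icc R' R) := by
    apply strictAntiOn_of_deriv_neg (convex_Icc _ _) hU2.cont
    intro x hx
    rw [interior_Icc] at hx
    rw [(hU2.hasDerivAt hx).deriv]
    exact hneg x ⟨hx.1, hx.2.le⟩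
  refine ⟨fun r hr => ?_, hanti, R', ⟨hR'K.1.1, hR'R⟩, fun r hr => hneg r ⟨hr.1, hr.2.le⟩, hconst⟩
  have hm : max r R' < R := max_lt hr.2 hR'R
  have h1 := hsa ⟨le_max_right r R', hm.le⟩ ⟨hR'R.le, le_rfl⟩ hm
  have h2 := hanti ⟨hr.1, hr.2.le⟩ ⟨hr.1.trans (le_max_left _ _), hm.le⟩ (le_max_left r R')
  linarith


section
variable {N : ℕ}

lemma radial_test {R : ℝ} {ψ : ℝ → ℝ} (h1 : ContDiff ℝ (⊤ : ℕ∞) ψ)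
    (h3 : tsupport ψ ⊆ Ioo 0 R) :
    IsTestFun (ball (0 : EuclideanSpace ℝ (Fin N)) R) (fun x => ψ ‖x‖) := by
  have hsub : tsupport (fun x : EuclideanSpace ℝ (Fin N) => ψ ‖x‖) ⊆ {x | ‖x‖ ∈ tsupport ψ} := by
    apply closure_minimal
    · intro x hx
      exact subset_tsupport _ hx
    · exact (isClosed_tsupport ψ).preimage continuous_norm
  refine ⟨?_, ?_, ?_⟩
  · rw [contDiff_iff_contDiffAt]
    intro x
    by_cases hx : x = 0
    · subst hx
      have h0 : (0:ℝ) ∉ tsupport ψ := fun h => lt_irrefl _ (h3 h).1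
      have h4 := notMem_tsupport_iff_eventuallyEq.1 h0
      have h5 : Filter.Tendsto (fun x : EuclideanSpace ℝ (Fin N) => ‖x‖) (nhds 0) (nhds 0) := by
        simpa using (continuous_norm (E := EuclideanSpace ℝ (Fin N))).tendsto 0
      have h6 : (fun x : EuclideanSpace ℝ (Fin N) => ψ ‖x‖) =ᶠ[nhds 0] fun _ => 0 := h5.eventually h4
      exact contDiffAt_const.congr_of_eventuallyEq h6
    · exact h1.contDiffAt.comp x (contDiffAt_norm ℝ hx)
  · refine (isCompact_closedBall (0 : EuclideanSpace ℝ (Fin N)) R).of_isClosed_subset (isClosed_tsupport _) ?_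
    intro x hx
    simpa using (h3 (hsub hx)).2.le
  · intro x hx
    simpa using (h3 (hsub hx)).2

lemma ray_deriv {R : ℝ} {u : EuclideanSpace ℝ (Fin N) → ℝ}
    {D : EuclideanSpace ℝ (Fin N) → (EuclideanSpace ℝ (Fin N) →L[ℝ] ℝ)}
    (hD : ∀ x ∈ closedBall 0 R, HasFDerivWithinAt u (D x) (closedBall 0 R) x)
    {e : EuclideanSpace ℝ (Fin N)} (he : ‖e‖ = 1) {r : ℝ} (hr : r ∈ Icc 0 R) :
    HasDerivWithinAt (fun r : ℝ => u (r • e)) (D (r • e) e) (Icc 0 R) r := by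
  have h1 : HasDerivWithinAt (fun r : ℝ => r • e) e (Icc 0 R) r := by
    simpa using ((hasDerivAt_id r).smul_const e).hasDerivWithinAt
  exact (hD _ (ray_maps he hr)).comp_hasDerivWithinAt r h1 (ray_maps he)

lemma main_radial (hN : 1 ≤ N) {R : ℝ} (hR : 0 < R) {g f : ℝ → ℝ} (hg : GCond g) (hf : Continuous f)
    {u : EuclideanSpace ℝ (Fin N) → ℝ}
    {D : EuclideanSpace ℝ (Fin N) → (EuclideanSpace ℝ (Fin N) →L[ℝ] ℝ)}
    (hDc : ContinuousOn D (closedBall 0 R))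
    (hD : ∀ x ∈ closedBall 0 R, HasFDerivWithinAt u (D x) (closedBall 0 R) x)
    (hu0 : ∀ x ∈ sphere (0 : EuclideanSpace ℝ (Fin N)) R, u x = 0)
    (hupos : ∀ x ∈ closedBall (0 : EuclideanSpace ℝ (Fin N)) R, 0 ≤ u x)
    (hmin : MinNN R g f u)
    (hnz : ∃ x ∈ closedBall (0:EuclideanSpace ℝ (Fin N)) R, u x ≠ 0)
    (hweak : IsDistribSolAut (ball 0 R) g f u)
    {a : EuclideanSpace ℝ (Fin N)} (ha : ‖a‖ = 1)
    (hrad : ∀ x ∈ closedBall (0 : EuclideanSpace ℝ (Fin N)) R, u x = u (‖x‖ • a)) :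
    (∀ x ∈ ball (0:EuclideanSpace ℝ (Fin N)) R, 0 < u x) ∧
    ∃ U U' : ℝ → ℝ, RadialNonincreasing R u U U' ∧
      ∃ R' ∈ Ico (0:ℝ) R, (∀ r ∈ Ioo R' R, U' r < 0) ∧ ∀ r ∈ Icc (0:ℝ) R', U r = U 0 := by
  haveI := nontrivial_E hN
  have hn : ∀ x ∈ ball (0 : EuclideanSpace ℝ (Fin N)) R, x ≠ 0 → ‖D x‖ = |D x (‖x‖⁻¹ • x)| :=
    fun x hx hx0 => radial_norm hN hR hg hf hDc hD hu0 hupos hmin hx hx0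
  set U : ℝ → ℝ := fun r => u (r • a) with hUdef
  set U' : ℝ → ℝ := fun r => D (r • a) a with hU'def
  have hU : C1On U U' 0 R := by
    refine ⟨(hDc.comp (by fun_prop) (ray_maps ha)).clm_apply continuousOn_const, fun r hr => ?_⟩
    exact ray_deriv hD ha hr
  -- derivative at 0
  have hU0 : U' 0 = 0 := by
    have hz : (0 : EuclideanSpace ℝ (Fin N)) ∈ ball 0 R := mem_ball_self hR
    have hd0 : HasFDerivAt u (D 0) 0 := hasFDerivAt_of_within hz (hD 0 (ball_subset_closedBall hz))
    have h1 : HasDerivAt (fun r : ℝ => r • a) a 0 := by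
      simpa using (hasDerivAt_id (0:ℝ)).smul_const a
    have h2 : HasDerivAt (fun r : ℝ => r • (-a)) (-a) 0 := by
      simpa using (hasDerivAt_id (0:ℝ)).smul_const (-a)
    have h3 : HasDerivAt (fun r : ℝ => u (r • a)) (D 0 a) 0 :=
      HasFDerivAt.comp_hasDerivAt (0:ℝ) (by simpa using hd0) h1
    have h4 : HasDerivAt (fun r : ℝ => u (r • (-a))) (D 0 (-a)) 0 :=
      HasFDerivAt.comp_hasDerivAt (0:ℝ) (by simpa using hd0) h2
    have h5 : (fun r : ℝ => u (r • a)) =ᶠ[nhds 0] fun r : ℝ => u (r • (-a)) := by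
      filter_upwards [ball_mem_nhds (0:ℝ) hR] with r hr
      have hr' : |r| < R := by simpa using hr
      rw [hrad (r • a) (by simp [norm_smul, ha, hr'.le]), hrad (r • (-a)) (by simp [norm_smul, ha, hr'.le])]
      simp [norm_smul]
    have h6 := h3.unique (h4.congr_of_eventuallyEq h5)
    simp only [map_neg] at h6
    simp only [hU'def, zero_smul]
    linarith
  -- radial derivative
  have hDr : ∀ x ∈ ball (0 : EuclideanSpace ℝ (Fin N)) R, x ≠ 0 → D x (‖x‖⁻¹ • x) = U' ‖x‖ := by
    intro x hx hx0
    have hxn : ‖x‖ ≠ 0 := norm_ne_zero_iff.2 hx0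
    have hxR : ‖x‖ ∈ Icc 0 R := ⟨norm_nonneg _, by simpa using ball_subset_closedBall hx⟩
    have h1 := ray_deriv hD (norm_unit hx0) hxR
    rw [smul_smul, mul_inv_cancel₀ hxn, one_smul] at h1
    have h2 := hU.2 _ hxR
    have h3 : HasDerivWithinAt (fun r : ℝ => u (r • (‖x‖⁻¹ • x))) (U' ‖x‖) (Icc 0 R) ‖x‖ := by
      have : ∀ r ∈ Icc 0 R, u (r • (‖x‖⁻¹ • x)) = U r := by
        intro r hr
        rw [hrad _ (ray_maps (norm_unit hx0) hr), norm_smul, norm_unit hx0, mul_one,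
          Real.norm_eq_abs, abs_of_nonneg hr.1]
      exact h2.congr this (this _ hxR)
    exact (uniqueDiffOn_Icc hR _ hxR).eq_deriv _ h1 h3
  have hDn : ∀ x ∈ ball (0 : EuclideanSpace ℝ (Fin N)) R, x ≠ 0 → ‖D x‖ = |U' ‖x‖| :=
    fun x hx hx0 => by rw [hn x hx hx0, hDr x hx hx0]
  have hur : ∀ x ∈ ball (0 : EuclideanSpace ℝ (Fin N)) R, u x = U ‖x‖ :=
    fun x hx => hrad x (ball_subset_closedBall hx)
  obtain ⟨C, hC, hrint⟩ := radial_integral hN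
  have hae : ∀ {s : Set (EuclideanSpace ℝ (Fin N))} {p q : EuclideanSpace ℝ (Fin N) → ℝ},
      MeasurableSet s → (∀ x ∈ s, x ≠ 0 → p x = q x) → ∫ x in s, p x = ∫ x in s, q x := by
    intro s p q hs hpq
    have h0 : (s \ {0} : Set _) =ᵐ[volume] s := diff_null_ae_eq_self (measure_singleton _)
    rw [← setIntegral_congr_set h0, ← setIntegral_congr_set h0]
    exact setIntegral_congr_fun (hs.diff (measurableSet_singleton _)) fun x hx => hpq x hx.1 hx.2
  have hball : ball (0 : EuclideanSpace ℝ (Fin N)) R = {x | ‖x‖ ∈ Iio R} := by ext x; simp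
  -- ODE
  have hode : ∀ r ∈ Ioo 0 R, HasDerivAt (fun r => r ^ (N - 1) * gh g (U' r))
      (-(r ^ (N - 1) * f (U r))) r := by
    have hUc := hU.cont.mono (Ioo_subset_Icc_self (a := 0) (b := R))
    have hU'c := (hU.1).mono (Ioo_subset_Icc_self (a := 0) (b := R))
    apply dbr
    · exact (by fun_prop : Continuous fun r : ℝ => r ^ (N - 1)).continuousOn.mul
        ((gh_continuous hg).comp_continuousOn hU'c)
    · exact (by fun_prop : Continuous fun r : ℝ => r ^ (N - 1)).continuousOn.mul
        (hf.comp_continuousOn hUc)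
    · intro ψ hψ1 hψ2 hψ3
      have hw := hweak _ (radial_test (N := N) hψ1 hψ3)
      have e1 : (∫ x in ball (0 : EuclideanSpace ℝ (Fin N)) R,
          ⟪gvec g (gradient u x), gradient (fun x => ψ ‖x‖) x⟫) =
          ∫ x in ball (0 : EuclideanSpace ℝ (Fin N)) R, (fun r => gh g (U' r) * deriv ψ r) ‖x‖ := by
        apply hae measurableSet_ball
        intro x hx hx0
        have hxn : ‖x‖ ≠ 0 := norm_ne_zero_iff.2 hx0
        have hux := hasFDerivAt_of_within hx (hD x (ball_subset_closedBall hx))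
        have h1 : HasFDerivAt (fun x : EuclideanSpace ℝ (Fin N) => ‖x‖) (innerSL ℝ (‖x‖⁻¹ • x)) x := by
          have h2 := ((hasStrictFDerivAt_norm_sq x).hasFDerivAt).sqrt (pow_ne_zero 2 hxn)
          have h3 : (fun y : EuclideanSpace ℝ (Fin N) => √(‖y‖ ^ 2)) = fun y => ‖y‖ := by
            ext y; exact Real.sqrt_sq (norm_nonneg y)
          rw [h3, Real.sqrt_sq (norm_nonneg x)] at h2
          refine h2.congr_fderiv ?_
          ext y
          simp
          ring
        have h4 : HasFDerivAt (fun x : EuclideanSpace ℝ (Fin N) => ψ ‖x‖)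
            (deriv ψ ‖x‖ • innerSL ℝ (‖x‖⁻¹ • x)) x :=
          ((hψ1.differentiable (by simp)) ‖x‖).hasDerivAt.comp_hasFDerivAt x h1
        rw [real_inner_comm, inner_gradient_eq h4]
        simp only [ContinuousLinearMap.smul_apply, innerSL_apply_apply, smul_eq_mul]
        have h5 : ⟪‖x‖⁻¹ • x, gradient u x⟫ = U' ‖x‖ := by
          rw [real_inner_comm, inner_gradient_eq hux, hDr x hx hx0]
        have h6 : ‖gradient u x‖ = |U' ‖x‖| := by rw [norm_gradient_eq hux, hDn x hx hx0]
        unfold gvec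
        split_ifs with h7
        · have : U' ‖x‖ = 0 := by rw [h7] at h6; simpa using h6.symm
          rw [this, gh_zero hg]; simp
        · have h8 : U' ‖x‖ ≠ 0 := by
            intro h; rw [h] at h6; exact h7 (by simpa using h6)
          rw [inner_smul_right, h5, h6]
          have : g |U' ‖x‖| / |U' ‖x‖| * U' ‖x‖ = gh g (U' ‖x‖) := by
            rcases lt_or_gt_of_ne h8 with h | h
            · rw [abs_of_neg h, ← neg_neg (gh g (U' ‖x‖)), ← gh_neg hg, gh_of_nonneg (by linarith)]
              field_simp
            · rw [abs_of_pos h, gh_of_nonneg h.le]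
              field_simp
          rw [this]; ring
      have e2 : (∫ x in ball (0 : EuclideanSpace ℝ (Fin N)) R, f (u x) * ψ ‖x‖) =
          ∫ x in ball (0 : EuclideanSpace ℝ (Fin N)) R, (fun r => f (U r) * ψ r) ‖x‖ := by
        apply setIntegral_congr_fun measurableSet_ball
        intro x hx
        simp only [hur x hx]
      rw [e1, e2, hball, hrint (fun r => gh g (U' r) * deriv ψ r) _ measurableSet_Iio,
        hrint (fun r => f (U r) * ψ r) _ measurableSet_Iio, Ioi_inter_Iio] at hw
      have := mul_left_cancel₀ hC.ne' hw
      simpa only [mul_assoc] using this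
  have hU_R : U R = 0 := hu0 _ (by simp [norm_smul, ha, abs_of_pos hR])
  have hUpos : ∀ r ∈ Icc 0 R, 0 ≤ U r := fun r hr => hupos _ (ray_maps ha hr)
  -- critical points
  have hcrit : ∀ r1 ∈ Ioc 0 R, U' r1 = 0 → ∀ r ∈ Ioo 0 r1, U' r = 0 := by
    intro r1 hr1 hcr
    apply ode_radial hg hf (N - 1) hU hode hr1 hcr
    have hgen : ∀ s : Set ℝ, MeasurableSet s → s ⊆ Iio R →
        ∫ x in {x : EuclideanSpace ℝ (Fin N) | ‖x‖ ∈ s}, (Gh g ‖D x‖ - Gfun f (u x) + Gfun f (U r1)) =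
        C * ∫ y in Ioi 0 ∩ s, y ^ (N - 1) * (Gh g (U' y) - Gfun f (U y) + Gfun f (U r1)) := by
      intro s hs hsR
      rw [← hrint (fun y => Gh g (U' y) - Gfun f (U y) + Gfun f (U r1)) s hs]
      apply hae (measurable_norm hs)
      intro x hx hx0
      have hxb : x ∈ ball (0 : EuclideanSpace ℝ (Fin N)) R := by simpa using hsR hx
      rw [hDn x hxb hx0, Gh_abs hg, hur x hxb]
    rcases eq_or_lt_of_le hr1.2 with h | h
    · have h1 := comp_ineq (d := U r1) hR hg hf hDc hD hu0 hupos hmin isClosed_univ (by simp)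
        (by rw [h, hU_R]) (fun _ _ _ => by rw [h, hU_R])
      rw [inter_univ, hball, hgen _ measurableSet_Iio le_rfl, Ioi_inter_Iio, ← h] at h1
      exact nonpos_of_mul_nonpos_right h1 hC
    · have h1 := comp_ineq (d := U r1) (A := closedBall 0 r1) hR hg hf hDc hD hu0 hupos hmin
        isClosed_closedBall (by
          intro x hx hxR
          rw [frontier_closedBall _ hr1.1.ne'] at hx
          have hxn : ‖x‖ = r1 := by simpa using hx
          have hxb : x ∈ ball (0 : EuclideanSpace ℝ (Fin N)) R := by simpa [hxn] using h
          have hx0 : x ≠ 0 := by rw [← norm_ne_zero_iff, hxn]; exact hr1.1.ne'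
          refine ⟨by rw [hur x hxb, hxn], ?_⟩
          rw [← norm_eq_zero, hDn x hxb hx0, hxn, hcr, abs_zero])
        (hUpos r1 ⟨hr1.1.le, hr1.2⟩) (by
          intro x hx hx'
          simp at hx hx'
          linarith)
      have h2 : ball (0 : EuclideanSpace ℝ (Fin N)) R ∩ closedBall 0 r1 = {x | ‖x‖ ∈ Iic r1} := by
        ext x
        simp only [mem_inter_iff, mem_ball_zero_iff, mem_closedBall_zero_iff, mem_Iic, mem_setOf_eq]
        exact ⟨fun h => h.2, fun h' => ⟨h'.trans_lt h, h'⟩⟩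
      rw [h2, hgen _ measurableSet_Iic (fun y hy => lt_of_le_of_lt hy h), Ioi_inter_Iic,
        integral_Ioc_eq_integral_Ioo] at h1
      exact nonpos_of_mul_nonpos_right h1 hC
  have hnz' : ∃ r ∈ Icc 0 R, U r ≠ 0 := by
    obtain ⟨x, hx, hx0⟩ := hnz
    refine ⟨‖x‖, ⟨norm_nonneg _, by simpa using hx⟩, ?_⟩
    rw [hUdef]; simp only; rwa [← hrad x hx]
  obtain ⟨p1, p2, p3⟩ := profile hR hU hUpos hU_R hnz' hU0 hcrit
  refine ⟨fun x hx => ?_, U, U', ⟨hU, p2, hrad⟩, p3⟩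
  rw [hur x hx]
  exact p1 _ ⟨norm_nonneg _, by simpa using hx⟩

end


lemma half_eq {V V' W W' : ℝ → ℝ} {p q R : ℝ} (hpR : p ≤ R) (hqR : q ≤ R)
    (hV : C1On V V' p R) (hW : C1On W W' q R)
    (hVn : ∀ r ∈ Ioc p R, V' r < 0) (hWn : ∀ r ∈ Ioc q R, W' r < 0)
    (hVp : V' p = 0) (hVR : V R = 0) (hWR : W R = 0)
    (hen : ∀ x ∈ Icc p R, ∀ y ∈ Icc q R, V x = W y → |V' x| = |W' y|)
    (hle : V p ≤ W q) : p = q ∧ ∀ x ∈ Icc p R, V x = W x := by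
  have hVa : StrictAntiOn V (Icc p R) := by
    apply strictAntiOn_of_deriv_neg (convex_Icc _ _) hV.cont
    intro x hx
    rw [interior_Icc] at hx
    rw [(hV.hasDerivAt hx).deriv]
    exact hVn x ⟨hx.1, hx.2.le⟩
  have hWa : StrictAntiOn W (Icc q R) := by
    apply strictAntiOn_of_deriv_neg (convex_Icc _ _) hW.cont
    intro x hx
    rw [interior_Icc] at hx
    rw [(hW.hasDerivAt hx).deriv]
    exact hWn x ⟨hx.1, hx.2.le⟩
  have hex : ∀ x ∈ Icc p R, ∃ y ∈ Icc q R, W y = V x := by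
    intro x hx
    apply intermediate_value_Icc' hqR hW.cont
    refine ⟨?_, (hVa.antitoneOn ⟨le_rfl, hpR⟩ hx hx.1).trans hle⟩
    rw [hWR, ← hVR]
    exact hVa.antitoneOn hx ⟨hpR, le_rfl⟩ hx.2
  choose! τ hτm hτ using hex
  have hτinj : InjOn τ (Icc p R) := by
    intro x hx y hy hxy
    apply hVa.injOn hx hy
    rw [← hτ x hx, ← hτ y hy, hxy]
  have hτR : τ R = R :=
    hWa.injOn (hτm R ⟨hpR, le_rfl⟩) ⟨hqR, le_rfl⟩ (by rw [hτ R ⟨hpR, le_rfl⟩, hVR, hWR])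
  have hτc : ContinuousOn τ (Icc p R) := by
    have hemb : Topology.IsClosedEmbedding ((Icc q R).restrict W) :=
      (continuousOn_iff_continuous_restrict.1 hW.cont).isClosedEmbedding (injOn_iff_injective.1 hWa.injOn)
    have h1 : Continuous (fun x : Icc p R => (⟨τ x, hτm x x.2⟩ : Icc q R)) := by
      rw [hemb.isInducing.continuous_iff]
      have : ((Icc q R).restrict W) ∘ (fun x : Icc p R => (⟨τ x, hτm x x.2⟩ : Icc q R)) =
          (Icc p R).restrict V := by
        ext x; exact hτ x x.2
      rw [this]
      exact continuousOn_iff_continuous_restrict.1 hV.cont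
    exact continuousOn_iff_continuous_restrict.2 (continuous_subtype_val.comp h1)
  have hτd : ∀ x ∈ Ioo p R, HasDerivAt τ 1 x := by
    intro x hx
    have hx' := Ioo_subset_Icc_self hx
    have hτo : τ x ∈ Ioo q R := by
      have h1 := hτm x hx'
      refine ⟨lt_of_le_of_ne h1.1 ?_, lt_of_le_of_ne h1.2 ?_⟩
      · intro h
        have h2 := hτ x hx'
        rw [← h] at h2
        have := hVa ⟨le_rfl, hpR⟩ hx' hx.1
        linarith
      · intro h
        rw [← hτR] at h
        exact hx.2.ne (hτinj hx' ⟨hpR, le_rfl⟩ h)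
    have hnb : ∀ᶠ y in nhdsWithin x {x}ᶜ, y ∈ Icc p R ∧ y ≠ x := by
      have h1 : ∀ᶠ y in nhdsWithin x {x}ᶜ, y ∈ Icc p R := nhdsWithin_le_nhds (Icc_mem_nhds hx.1 hx.2)
      filter_upwards [h1, self_mem_nhdsWithin] with y h1 h2 using ⟨h1, h2⟩
    have hVd := (hV.hasDerivAt hx).tendsto_slope
    have hWd := (hW.hasDerivAt hτo).tendsto_slope
    have hτt : Filter.Tendsto τ (nhdsWithin x {x}ᶜ) (nhdsWithin (τ x) {τ x}ᶜ) := by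
      apply tendsto_nhdsWithin_of_tendsto_nhds_of_eventually_within
      · exact ((hτc.continuousAt (Icc_mem_nhds hx.1 hx.2)).tendsto).mono_left nhdsWithin_le_nhds
      · filter_upwards [hnb] with y hy
        exact fun h => hy.2 (hτinj hy.1 hx' h)
    have hW0 : W' (τ x) < 0 := hWn _ ⟨hτo.1, hτo.2.le⟩
    have hV0 : V' x < 0 := hVn _ ⟨hx.1, hx.2.le⟩
    have hq := hVd.div (hWd.comp hτt) hW0.ne
    have hone : V' x / W' (τ x) = 1 := by
      have := hen x hx' (τ x) (hτm x hx') (hτ x hx').symm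
      rw [abs_of_neg hV0, abs_of_neg hW0] at this
      rw [div_eq_one_iff_eq hW0.ne]; linarith
    rw [hone] at hq
    rw [hasDerivAt_iff_tendsto_slope]
    apply hq.congr'
    filter_upwards [hnb] with y hy
    have h1 : τ y - τ x ≠ 0 := sub_ne_zero.2 fun h => hy.2 (hτinj hy.1 hx' h)
    have h2 : y - x ≠ 0 := sub_ne_zero.2 hy.2
    have h3 : V y - V x ≠ 0 := sub_ne_zero.2 fun h => hy.2 (hVa.injOn hy.1 hx' h)
    simp only [Pi.div_apply, Function.comp_apply, slope_def_field, hτ y hy.1, hτ x hx']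
    field_simp
  have hid : ∀ x ∈ Icc p R, τ x = x := by
    intro x hx
    rcases eq_or_lt_of_le hx.2 with h | h
    · rw [h, hτR]
    · obtain ⟨z, hz, hz'⟩ := exists_hasDerivAt_eq_slope (fun y => τ y - y) (fun y => 1 - 1) h
        ((hτc.mono (Icc_subset_Icc_left hx.1)).sub continuousOn_id)
        (fun z hz => (hτd z ⟨hx.1.trans_lt hz.1, hz.2⟩).sub (hasDerivAt_id z))
      rw [eq_div_iff (by linarith)] at hz'
      linarith
  have hVW : ∀ x ∈ Icc p R, V x = W x := by
    intro x hx
    have := hτ x hx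
    rw [hid x hx] at this
    exact this.symm
  refine ⟨?_, hVW⟩
  have hpp : p ∈ Icc p R := ⟨le_rfl, hpR⟩
  have hpq : p ∈ Icc q R := by simpa [hid p hpp] using hτm p hpp
  rcases eq_or_lt_of_le hpq.1 with h | h
  · exact h.symm
  · have h1 := hen p hpp p hpq (hVW p hpp)
    rw [hVp, abs_zero] at h1
    have := hWn p ⟨h, hpq.2⟩
    rw [abs_of_neg this] at h1
    linarith

lemma even_1d {R : ℝ} (hR : 0 < R) {g f : ℝ → ℝ} (hg : GCond g) (hf : Continuous f)
    {U U' : ℝ → ℝ} (hU : C1On U U' (-R) R)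
    (hode : ∀ r ∈ Ioo (-R) R, HasDerivAt (fun r => gh g (U' r)) (-(f (U r))) r)
    (hpos : ∀ r ∈ Icc (-R) R, 0 ≤ U r) (hUR : U R = 0) (hUR' : U (-R) = 0)
    (hvar : ∀ c1 ∈ Icc (-R) R, ∀ c2 ∈ Icc (-R) R, c1 < c2 → U' c1 = 0 → U' c2 = 0 → U c1 = U c2 →
      ∫ y in Ioo c1 c2, (Gh g (U' y) - Gfun f (U y) + Gfun f (U c1)) ≤ 0) :
    ∀ t ∈ Icc (-R) R, U (-t) = U t := by
  set E : ℝ → ℝ := fun y => Hh g (U' y) + Gfun f (U y) with hE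
  have hEc : ContinuousOn E (Icc (-R) R) :=
    ((Hh_continuous hg).comp_continuousOn hU.1).add ((Gfun_continuous hf).comp_continuousOn hU.cont)
  have hEd : ∀ r ∈ Ioo (-R) R, HasDerivAt E 0 r := by
    intro r hr
    have h6 := energy_hasDerivAt hg (hU.1.continuousAt (Icc_mem_nhds hr.1 hr.2)) (hode r hr)
    have h7 := (Gfun_hasDerivAt hf (U r)).comp r (hU.hasDerivAt hr)
    refine (h6.add h7).congr_deriv ?_
    ring
  have hEconst : ∀ x ∈ Icc (-R) R, E x = E (-R) := by
    intro x hx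
    rcases eq_or_lt_of_le hx.1 with h | h
    · rw [h]
    · obtain ⟨z, hz, hz'⟩ := exists_hasDerivAt_eq_slope E (fun y => 0) h
        (hEc.mono (Icc_subset_Icc_right hx.2))
        (fun z hz => hEd z ⟨hz.1, hz.2.trans_le hx.2⟩)
      rw [eq_div_iff (by linarith)] at hz'
      linarith
  have hen : ∀ x ∈ Icc (-R) R, ∀ y ∈ Icc (-R) R, U x = U y → |U' x| = |U' y| := by
    intro x hx y hy hxy
    apply Hh_inj hg
    have h1 := hEconst x hx
    have h2 := hEconst y hy
    simp only [hE] at h1 h2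
    rw [hxy] at h1
    linarith
  set K : Set ℝ := Icc (-R) R ∩ U' ⁻¹' {0} with hK
  have hKc : IsCompact K := by
    apply isCompact_Icc.of_isClosed_subset _ inter_subset_left
    exact hU.1.preimage_isClosed_of_isClosed isClosed_Icc isClosed_singleton
  have hKn : K.Nonempty := by
    obtain ⟨c, hc, hc0⟩ := exists_hasDerivAt_eq_zero (f := U) (f' := U') (by linarith : -R < R) hU.cont
      (by rw [hUR, hUR']) (fun x hx => hU.hasDerivAt hx)
    exact ⟨c, Ioo_subset_Icc_self hc, hc0⟩
  obtain ⟨c2, hc2, hc2max⟩ := hKc.exists_isGreatest hKn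
  obtain ⟨c1, hc1, hc1min⟩ := hKc.exists_isLeast hKn
  have hc1z : U' c1 = 0 := hc1.2
  have hc2z : U' c2 = 0 := hc2.2
  set V : ℝ → ℝ := fun t => U (-t) with hVdef
  set V' : ℝ → ℝ := fun t => - U' (-t) with hV'def
  have hnegmaps : MapsTo (fun t : ℝ => -t) (Icc (-R) R) (Icc (-R) R) := by
    intro t ht; exact ⟨by linarith [ht.2], by linarith [ht.1]⟩
  have hV : C1On V V' (-R) R := by
    refine ⟨(hU.1.comp continuous_neg.continuousOn hnegmaps).neg, fun t ht => ?_⟩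
    have := (hU.2 (-t) (hnegmaps ht)).comp t (hasDerivAt_neg t).hasDerivWithinAt hnegmaps
    exact this.congr_deriv (by simp [hV'def])
  have hs2 : Icc c2 R ⊆ Icc (-R) R := Icc_subset_Icc_left hc2.1.1
  have hs1 : Icc (-c1) R ⊆ Icc (-R) R := Icc_subset_Icc_left (by linarith [hc1.1.2])
  have hU2 : C1On U U' c2 R := ⟨hU.1.mono hs2, fun r hr => (hU.2 r (hs2 hr)).mono hs2⟩
  have hV2 : C1On V V' (-c1) R := ⟨hV.1.mono hs1, fun r hr => (hV.2 r (hs1 hr)).mono hs1⟩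
  have hUn := sign_right hU2 (fun r hr => hpos r (hs2 hr)) hUR (by
    intro r hr h
    have := hc2max ⟨⟨hc2.1.1.trans hr.1.le, hr.2⟩, h⟩
    linarith [hr.1])
  have hVR : V R = 0 := hUR'
  have hVn := sign_right hV2 (fun r hr => hpos (-r) (hnegmaps (hs1 hr))) hVR (by
    intro r hr h
    have h' : U' (-r) = 0 := by simpa [hV'def] using h
    have := hc1min ⟨hnegmaps (hs1 (Ioc_subset_Icc_self hr)), h'⟩
    linarith [hr.1])
  have hVen : ∀ x ∈ Icc (-c1) R, ∀ y ∈ Icc c2 R, V x = U y → |V' x| = |U' y| := by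
    intro x hx y hy hxy
    simp only [hV'def, abs_neg]
    exact hen _ (hnegmaps (hs1 hx)) _ (hs2 hy) hxy
  have hVc : V' (-c1) = 0 := by simp [hV'def, hc1z]
  have hmain : -c1 = c2 ∧ ∀ x ∈ Icc c2 R, V x = U x := by
    rcases le_total (V (-c1)) (U c2) with h | h
    · have := half_eq (by linarith [hc1.1.1]) hc2.1.2 hV2 hU2 hVn hUn hVc hVR hUR hVen h
      refine ⟨this.1, ?_⟩
      rw [← this.1]; exact this.2
    · have := half_eq hc2.1.2 (by linarith [hc1.1.1]) hU2 hV2 hUn hVn hc2z hUR hVR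
        (fun x hx y hy hxy => (hVen y hy x hx hxy.symm).symm) h
      exact ⟨this.1.symm, fun x hx => (this.2 x hx).symm⟩
  obtain ⟨h12, hVU⟩ := hmain
  have hc12 : c1 ≤ c2 := hc1min hc2
  have hc1e : c1 = -c2 := by linarith
  have hval : U c1 = U c2 := by
    have := hVU c2 ⟨le_rfl, hc2.1.2⟩
    simpa [hVdef, hc1e] using this
  have hconst : ∀ r ∈ Icc c1 c2, U r = U c1 := by
    rcases eq_or_lt_of_le hc12 with h | h
    · intro r hr
      have : r = c1 := le_antisymm (hr.2.trans h.ge) hr.1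
      rw [this]
    have hs : Icc c1 R ⊆ Icc (-R) R := Icc_subset_Icc_left hc1.1.1
    have hU1 : C1On U U' c1 R := ⟨hU.1.mono hs, fun r hr => (hU.2 r (hs hr)).mono hs⟩
    apply const_of_zero hU1 hc2.1.2
    have h1 := hvar c1 hc1.1 c2 hc2.1 h hc1z hc2z hval
    have hE1 : E c1 = Gfun f (U c1) := by simp [hE, hc1z, Hh_zero]
    have hsub : Icc c1 c2 ⊆ Icc (-R) R := Icc_subset_Icc hc1.1.1 hc2.1.2
    have h2 : ∫ y in Ioo c1 c2, (Gh g (U' y) - Gfun f (U y) + Gfun f (U c1)) =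
        ∫ y in Ioo c1 c2, U' y * gh g (U' y) := by
      apply setIntegral_congr_fun measurableSet_Ioo
      intro y hy
      have h3 := hEconst y (hsub (Ioo_subset_Icc_self hy))
      rw [← hEconst c1 hc1.1, hE1] at h3
      simp only [hE, Hh] at h3
      simp only
      linarith
    rw [h2] at h1
    have hc := (hU.1.mul ((gh_continuous hg).comp_continuousOn hU.1)).mono hsub
    intro r hr
    exact mul_gh_eq_zero hg (zero_of_int hc (fun y _ => mul_gh_nonneg hg _) h1 r hr)
  have hnonneg : ∀ t ∈ Icc 0 R, U (-t) = U t := by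
    intro t ht
    rcases le_total c2 t with h | h
    · exact hVU t ⟨h, ht.2⟩
    · rw [hconst t ⟨by linarith [ht.1], h⟩, hconst (-t) ⟨by linarith, by linarith [ht.1]⟩]
  intro t ht
  rcases le_total 0 t with h | h
  · exact hnonneg t ⟨h, ht.2⟩
  · have := hnonneg (-t) ⟨by linarith, by linarith [ht.1]⟩
    rw [neg_neg] at this
    exact this.symm


lemma even_N1 {R : ℝ} (hR : 0 < R) {g f : ℝ → ℝ} (hg : GCond g) (hf : Continuous f)
    {u : EuclideanSpace ℝ (Fin 1) → ℝ}
    {D : EuclideanSpace ℝ (Fin 1) → (EuclideanSpace ℝ (Fin 1) →L[ℝ] ℝ)}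
    (hDc : ContinuousOn D (closedBall 0 R))
    (hD : ∀ x ∈ closedBall 0 R, HasFDerivWithinAt u (D x) (closedBall 0 R) x)
    (hu0 : ∀ x ∈ sphere (0 : EuclideanSpace ℝ (Fin 1)) R, u x = 0)
    (hupos : ∀ x ∈ closedBall (0 : EuclideanSpace ℝ (Fin 1)) R, 0 ≤ u x)
    (hmin : MinNN R g f u)
    (hweak : IsDistribSolAut (ball 0 R) g f u) :
    ∃ a : EuclideanSpace ℝ (Fin 1), ‖a‖ = 1 ∧
      ∀ x ∈ closedBall (0 : EuclideanSpace ℝ (Fin 1)) R, u x = u (‖x‖ • a) := by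
  set p : EuclideanSpace ℝ (Fin 1) ≃ₗᵢ[ℝ] ℝ :=
    (OrthonormalBasis.singleton (Fin 1) ℝ).repr.symm with hp
  set e : EuclideanSpace ℝ (Fin 1) := p.symm 1 with he
  have hen : ‖e‖ = 1 := by rw [he, p.symm.norm_map]; simp
  have hpe : ∀ t : ℝ, p (t • e) = t := by
    intro t; rw [map_smul, he, p.apply_symm_apply]; simp
  have hxe : ∀ x, x = p x • e := by
    intro x; apply p.injective; rw [hpe]
  have hpn : ∀ x, ‖x‖ = |p x| := by
    intro x; rw [← p.norm_map x, Real.norm_eq_abs]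
  have hmaps : MapsTo (fun r : ℝ => r • e) (Icc (-R) R) (closedBall 0 R) := by
    intro r hr
    simp [norm_smul, hen, abs_le, hr.1, hr.2]
  have hDe : ∀ x y, D x y = p y * D x e := by
    intro x y
    conv_lhs => rw [hxe y]
    rw [map_smul, smul_eq_mul]
  have hDn : ∀ x, ‖D x‖ = |D x e| := by
    intro x
    apply le_antisymm
    · apply ContinuousLinearMap.opNorm_le_bound _ (abs_nonneg _)
      intro y
      rw [hDe x y, hpn y, Real.norm_eq_abs, abs_mul, mul_comm]
    · have := (D x).le_opNorm e
      rwa [hen, mul_one, Real.norm_eq_abs] at this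
  have hmp : MeasurePreserving (p : EuclideanSpace ℝ (Fin 1) → ℝ) volume volume :=
    p.measurePreserving
  have hemb : MeasurableEmbedding (p : EuclideanSpace ℝ (Fin 1) → ℝ) :=
    p.toHomeomorph.measurableEmbedding
  have hInt : ∀ (h : ℝ → ℝ) (s : Set ℝ),
      ∫ x in (p : EuclideanSpace ℝ (Fin 1) → ℝ) ⁻¹' s, h (p x) = ∫ t in s, h t :=
    fun h s => hmp.setIntegral_preimage_emb hemb h s
  have hball : ball (0 : EuclideanSpace ℝ (Fin 1)) R = p ⁻¹' Ioo (-R) R := by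
    ext x; simp only [mem_ball_zero_iff, hpn x, abs_lt, mem_preimage, mem_Ioo]
  set U : ℝ → ℝ := fun r => u (r • e) with hUdef
  set U' : ℝ → ℝ := fun r => D (r • e) e with hU'def
  have hU : C1On U U' (-R) R := by
    refine ⟨(hDc.comp (by fun_prop) hmaps).clm_apply continuousOn_const, fun r hr => ?_⟩
    have h1 : HasDerivWithinAt (fun r : ℝ => r • e) e (Icc (-R) R) r := by
      simpa using ((hasDerivAt_id r).smul_const e).hasDerivWithinAt
    exact (hD _ (hmaps hr)).comp_hasDerivWithinAt r h1 hmaps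
  have hux' : ∀ x, u x = U (p x) := fun x => by rw [hUdef]; simp only; rw [← hxe x]
  have hDx' : ∀ x, D x e = U' (p x) := fun x => by rw [hU'def]; simp only; rw [← hxe x]
  have hode : ∀ r ∈ Ioo (-R) R, HasDerivAt (fun r => gh g (U' r)) (-(f (U r))) r := by
    have hUc := hU.cont.mono (Ioo_subset_Icc_self (a := -R) (b := R))
    have hU'c := (hU.1).mono (Ioo_subset_Icc_self (a := -R) (b := R))
    apply dbr
    · exact (gh_continuous hg).comp_continuousOn hU'c
    · exact hf.comp_continuousOn hUc
    · intro ψ hψ1 hψ2 hψ3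
      have hsub : tsupport (fun x : EuclideanSpace ℝ (Fin 1) => ψ (p x)) ⊆ p ⁻¹' tsupport ψ := by
        apply closure_minimal
        · intro x hx
          exact subset_tsupport ψ hx
        · exact (isClosed_tsupport ψ).preimage p.continuous
      have htest : IsTestFun (ball (0 : EuclideanSpace ℝ (Fin 1)) R) (fun x => ψ (p x)) := by
        have h3 : tsupport (fun x : EuclideanSpace ℝ (Fin 1) => ψ (p x)) ⊆ ball 0 R := by
          rw [hball]; exact fun x hx => hψ3 (hsub hx)
        refine ⟨hψ1.comp p.contDiff, ?_, h3⟩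
        exact (isCompact_closedBall (0 : EuclideanSpace ℝ (Fin 1)) R).of_isClosed_subset
          (isClosed_tsupport _) (h3.trans ball_subset_closedBall)
      have hw := hweak _ htest
      have e1 : (∫ x in ball (0 : EuclideanSpace ℝ (Fin 1)) R,
          ⟪gvec g (gradient u x), gradient (fun x => ψ (p x)) x⟫) =
          ∫ x in ball (0 : EuclideanSpace ℝ (Fin 1)) R, (fun r => gh g (U' r) * deriv ψ r) (p x) := by
        apply setIntegral_congr_fun measurableSet_ball
        intro x hx
        have hux := hasFDerivAt_of_within hx (hD x (ball_subset_closedBall hx))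
        have h4 : HasFDerivAt (fun x : EuclideanSpace ℝ (Fin 1) => ψ (p x))
            (deriv ψ (p x) • (p.toContinuousLinearEquiv : EuclideanSpace ℝ (Fin 1) →L[ℝ] ℝ)) x :=
          ((hψ1.differentiable (by simp)) (p x)).hasDerivAt.comp_hasFDerivAt x
            p.toContinuousLinearEquiv.hasFDerivAt
        have hin : ∀ y, p y = ⟪y, e⟫ := by
          intro y
          rw [← p.inner_map_map y e]
          have : p e = 1 := by rw [he, p.apply_symm_apply]
          rw [this]; simp
        have h5 : p (gradient u x) = U' (p x) := by
          rw [hin, inner_gradient_eq hux, hDx']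
        have h6 : ‖gradient u x‖ = |U' (p x)| := by rw [norm_gradient_eq hux, hDn x, hDx']
        simp only
        rw [real_inner_comm, inner_gradient_eq h4]
        have h9 : ∀ y, (deriv ψ (p x) • (p.toContinuousLinearEquiv : EuclideanSpace ℝ (Fin 1) →L[ℝ] ℝ)) y
          = deriv ψ (p x) * p y := fun y => rfl
        rw [h9]
        unfold gvec
        split_ifs with h7
        · have : U' (p x) = 0 := by rw [h7] at h6; simpa using h6.symm
          rw [this, gh_zero hg]; simp
        · have h8 : U' (p x) ≠ 0 := by
            intro h; rw [h] at h6; exact h7 (by simpa using h6)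
          rw [map_smul, h5, h6, smul_eq_mul]
          have : g |U' (p x)| / |U' (p x)| * U' (p x) = gh g (U' (p x)) := by
            rcases lt_or_gt_of_ne h8 with h | h
            · rw [abs_of_neg h, ← neg_neg (gh g (U' (p x))), ← gh_neg hg, gh_of_nonneg (by linarith)]
              field_simp
            · rw [abs_of_pos h, gh_of_nonneg h.le]
              field_simp
          rw [this]; ring
      have e2 : (∫ x in ball (0 : EuclideanSpace ℝ (Fin 1)) R, f (u x) * ψ (p x)) =
          ∫ x in ball (0 : EuclideanSpace ℝ (Fin 1)) R, (fun r => f (U r) * ψ r) (p x) := by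
        apply setIntegral_congr_fun measurableSet_ball
        intro x hx
        simp only [hux' x]
      rw [e1, e2, hball, hInt (fun r => gh g (U' r) * deriv ψ r), hInt (fun r => f (U r) * ψ r)] at hw
      exact hw
  have hUR : U R = 0 := hu0 _ (by simp [norm_smul, hen, abs_of_pos hR])
  have hUR' : U (-R) = 0 := hu0 _ (by simp [norm_smul, hen, abs_of_pos hR])
  have hUpos : ∀ r ∈ Icc (-R) R, 0 ≤ U r := fun r hr => hupos _ (hmaps hr)
  have heven := even_1d hR hg hf hU hode hUpos hUR hUR' (by
    intro c1 hc1 c2 hc2 h12 hz1 hz2 heq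
    have h1 := comp_ineq (d := U c1) (A := p ⁻¹' Icc c1 c2) hR hg hf hDc hD hu0 hupos hmin
      (isClosed_Icc.preimage p.continuous) (by
        intro x hx _
        have hx2 := p.continuous.frontier_preimage_subset _ hx
        rw [frontier_Icc h12.le] at hx2
        have hD0 : U' (p x) = 0 → D x = 0 := by
          intro h; rw [← norm_eq_zero, hDn, hDx', h, abs_zero]
        rcases hx2 with hx2 | hx2
        · rw [hux', hx2]; exact ⟨rfl, hD0 (by rw [hx2, hz1])⟩
        · rw [mem_singleton_iff] at hx2
          rw [hux', hx2]; exact ⟨heq.symm, hD0 (by rw [hx2, hz2])⟩)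
      (hUpos c1 hc1) (by
        intro x hx hxs
        have hxs' : |p x| = R := by rw [← hpn]; simpa using hxs
        rcases (abs_eq hR.le).1 hxs' with h | h
        · have : c2 = R := le_antisymm hc2.2 (h ▸ hx.2)
          rw [heq, this, hUR]
        · have : c1 = -R := le_antisymm (h ▸ hx.1) hc1.1
          rw [this, hUR'])
    have h2 : ∫ x in ball 0 R ∩ p ⁻¹' Icc c1 c2, (Gh g ‖D x‖ - Gfun f (u x) + Gfun f (U c1)) =
        ∫ x in p ⁻¹' (Ioo (-R) R ∩ Icc c1 c2),
          (fun y => Gh g (U' y) - Gfun f (U y) + Gfun f (U c1)) (p x) := by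
      rw [hball, preimage_inter]
      congr 1
      ext x
      simp only
      rw [hDn, hDx', Gh_abs hg, ← hux']
    rw [h2, hInt (fun y => Gh g (U' y) - Gfun f (U y) + Gfun f (U c1))] at h1
    have h3 : (Ioo (-R) R ∩ Icc c1 c2 : Set ℝ) =ᵐ[volume] Ioo c1 c2 := by
      have h4 : (Icc (-R) R ∩ Icc c1 c2 : Set ℝ) = Icc c1 c2 :=
        inter_eq_right.2 (Icc_subset_Icc hc1.1 hc2.2)
      have h5 : (Ioo (-R) R ∩ Icc c1 c2 : Set ℝ) =ᵐ[volume] (Icc (-R) R ∩ Icc c1 c2 : Set ℝ) :=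
        Ioo_ae_eq_Icc.inter (ae_eq_refl _)
      rw [h4] at h5
      exact h5.trans Ioo_ae_eq_Icc.symm
    rwa [setIntegral_congr_set h3] at h1)
  refine ⟨e, hen, fun x hx => ?_⟩
  have hx' : |p x| ≤ R := by rw [← hpn]; simpa using hx
  rw [hux', hpn]
  rcases abs_cases (p x) with h | h
  · rw [h.1]
  · rw [h.1]; exact (heven _ (abs_le.1 hx')).symm



/-- Theorem 4.2: a weak solution of (P) (autonomous `f`) which is a global minimizer of
`J` in `X` is positive in `B_R`, radially symmetric, radially non-increasing, strictly
decreasing in `(R',R)` and constant in `[0,R']` for some `R' ∈ [0,R)`. -/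
theorem global_minimizer_radial
    {N : ℕ} (hN : 1 ≤ N) (R : ℝ) (hR : 0 < R) (g f : ℝ → ℝ)
    (hg : GCond g) (hf : ContinuousOn f (Ici 0))
    (u : EuclideanSpace ℝ (Fin N) → ℝ) (hu : IsWeakSolPAut R g f u)
    (hmin : IsGlobalMinJ g f (ball (0:EuclideanSpace ℝ (Fin N)) R) u) :
    (∀ x ∈ ball (0:EuclideanSpace ℝ (Fin N)) R, 0 < u x) ∧
    ∃ U U' : ℝ → ℝ, RadialNonincreasing R u U U' ∧
      ∃ R' ∈ Ico (0:ℝ) R, (∀ r ∈ Ioo R' R, U' r < 0) ∧ ∀ r ∈ Icc (0:ℝ) R', U r = U 0 := by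
  obtain ⟨hu1, hupos, hnz, hu0, hweak⟩ := hu
  set F : ℝ → ℝ := fun t => f (max t 0) with hF
  have hFc : Continuous F := hf.comp_continuous (by fun_prop) (fun t => mem_Ici.2 (le_max_right t 0))
  have hFe : ∀ t, 0 ≤ t → F t = f t := fun t ht => by simp [hF, ht]
  have hGe : ∀ t, 0 ≤ t → Gfun F t = Gfun f t := by
    intro t ht
    unfold Gfun
    apply intervalIntegral.integral_congr
    intro s hs
    rw [uIcc_of_le ht] at hs
    exact hFe s hs.1
  have hJ : ∀ v : EuclideanSpace ℝ (Fin N) → ℝ,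
      (∀ x ∈ closedBall (0 : EuclideanSpace ℝ (Fin N)) R, 0 ≤ v x) →
      Jfun g F (ball 0 R) v = Jfun g f (ball 0 R) v := by
    intro v hv
    apply setIntegral_congr_fun measurableSet_ball
    intro x hx
    simp only
    rw [hGe _ (hv x (ball_subset_closedBall hx))]
  have hminF : MinNN R g F u := by
    intro v hv1 hv2 hv3
    rw [hJ u hupos, hJ v hv3]
    apply hmin.2
    haveI := nontrivial_E hN
    refine ⟨?_, ?_⟩
    · rwa [closure_ball _ hR.ne']
    · rwa [frontier_ball _ hR.ne']
  have hweakF : IsDistribSolAut (ball 0 R) g F u := by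
    intro φ hφ
    rw [hweak φ hφ]
    apply setIntegral_congr_fun measurableSet_ball
    intro x hx
    simp only
    rw [hFe _ (hupos x (ball_subset_closedBall hx))]
  obtain ⟨D, hDc, hD⟩ := exists_D hR hu1
  have key : ∃ a : EuclideanSpace ℝ (Fin N), ‖a‖ = 1 ∧
      ∀ x ∈ closedBall (0 : EuclideanSpace ℝ (Fin N)) R, u x = u (‖x‖ • a) := by
    rcases eq_or_lt_of_le hN with h1 | h2
    · subst h1
      exact even_N1 hR hg hFc hDc hD hu0 hupos hminF hweakF
    · haveI := nontrivial_E hN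
      obtain ⟨a, ha⟩ := exists_norm_eq (EuclideanSpace ℝ (Fin N)) (zero_le_one' ℝ)
      have hn : ∀ x ∈ ball (0 : EuclideanSpace ℝ (Fin N)) R, x ≠ 0 → ‖D x‖ = |D x (‖x‖⁻¹ • x)| :=
        fun x hx hx0 => radial_norm hN hR hg hFc hDc hD hu0 hupos hminF hx hx0
      refine ⟨a, ha, fun x hx => ?_⟩
      by_cases hx0 : x = 0
      · simp [hx0]
      · have h := sphere_const h2 hR hD hu0 hn ha (norm_unit hx0)
          (r := ‖x‖) ⟨norm_nonneg _, by simpa using hx⟩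
        rwa [smul_smul, mul_inv_cancel₀ (norm_ne_zero_iff.2 hx0), one_smul] at h
  obtain ⟨a, ha, hrad⟩ := key
  exact main_radial hN hR hg hFc hDc hD hu0 hupos hminF hnz hweakF ha hrad
end

section
/- Let N ≥ 2, p > 2 and s ≥ p/(p−2). Then there exist a Lipschitz continuous function f : [0,2] → ℝ and a function u ∈ C^1(closure(B₆)) with u > 0 in B₆, u = 0 on ∂B₆, such that u is a distributional solution of −div(|∇u|^{p−2}∇u) = f(u) in B₆ (i.e. ∫_{B₆} |∇u|^{p−2} ∇u·∇φ dx = ∫_{B₆} f(u) φ dx for all φ ∈ C_c^∞(B₆)) and u is not radially symmetric with respect to the origin (there is no function U with u(x) = U(|x|) for all x ∈ B₆). -/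
open Set Metric MeasureTheory Bornology
open scoped RealInnerProductSpace Classical

/-- Positive part raised to a power. -/
noncomputable def posPow (c t : ℝ) : ℝ := max t 0 ^ c

lemma posPow_of_nonneg {c t : ℝ} (ht : 0 ≤ t) : posPow c t = t ^ c := by
  simp [posPow, max_eq_left ht]

lemma posPow_of_nonpos {c t : ℝ} (hc : c ≠ 0) (ht : t ≤ 0) : posPow c t = 0 := by
  simp [posPow, max_eq_right ht, Real.zero_rpow hc]

lemma posPow_nonneg (c t : ℝ) : 0 ≤ posPow c t := by
  unfold posPow; positivity

lemma continuous_posPow {c : ℝ} (hc : 0 < c) : Continuous (posPow c) := by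
  unfold posPow
  exact (continuous_id.max continuous_const).rpow_const (fun _ => Or.inr hc.le)

lemma hasDerivAt_posPow {c : ℝ} (hc : 1 < c) (t : ℝ) :
    HasDerivAt (posPow c) (c * posPow (c - 1) t) t := by
  rcases lt_trichotomy t 0 with ht | ht | ht
  · rw [posPow_of_nonpos (by linarith) ht.le, mul_zero]
    refine (hasDerivAt_const t (0:ℝ)).congr_of_eventuallyEq ?_
    filter_upwards [gt_mem_nhds ht] with y hy
    exact posPow_of_nonpos (by linarith) hy.le
  · subst ht
    rw [posPow_of_nonpos (by linarith) le_rfl, mul_zero]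
    have h := hasDerivAt_abs_rpow 0 hc
    rw [hasDerivAt_iff_isLittleO] at h ⊢
    refine Asymptotics.IsBigO.trans_isLittleO ?_ h
    refine Asymptotics.IsBigO.of_bound 1 (Filter.Eventually.of_forall fun y => ?_)
    have h0 : posPow c 0 = 0 := posPow_of_nonpos (by linarith) le_rfl
    simp only [h0, sub_zero, mul_zero, smul_zero, abs_zero, one_mul,
      Real.zero_rpow (by linarith : c ≠ 0), Real.norm_eq_abs]
    rw [abs_of_nonneg (posPow_nonneg _ _), abs_of_nonneg (by positivity)]
    exact Real.rpow_le_rpow (le_max_right _ _) (max_le (le_abs_self _) (abs_nonneg _)) (by linarith)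
  · rw [posPow_of_nonneg ht.le]
    refine (Real.hasDerivAt_rpow_const (Or.inl ht.ne')).congr_of_eventuallyEq ?_
    filter_upwards [lt_mem_nhds ht] with y hy
    exact posPow_of_nonneg hy.le

lemma contDiff_posPow {c : ℝ} (hc : 1 < c) : ContDiff ℝ 1 (posPow c) := by
  rw [contDiff_one_iff_deriv]
  refine ⟨fun t => (hasDerivAt_posPow hc t).differentiableAt, ?_⟩
  rw [show deriv (posPow c) = fun t => c * posPow (c - 1) t from
    funext fun t => (hasDerivAt_posPow hc t).deriv]
  exact continuous_const.mul (continuous_posPow (by linarith))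

/-- The building block `(α + β |x - z|^q)_+^c`. -/
noncomputable def bump {N : ℕ} (q α β : ℝ) (z : EuclideanSpace ℝ (Fin N)) (c : ℝ)
    (x : EuclideanSpace ℝ (Fin N)) : ℝ := posPow c (α + β * ‖x - z‖ ^ q)

lemma contDiff_bump {N : ℕ} {q : ℝ} (hq : 1 < q) (α β : ℝ) (z : EuclideanSpace ℝ (Fin N))
    {c : ℝ} (hc : 1 < c) : ContDiff ℝ 1 (bump q α β z c) := by
  unfold bump
  refine (contDiff_posPow hc).comp ?_
  exact contDiff_const.add (contDiff_const.mul
    ((contDiff_id.sub contDiff_const).norm_rpow hq))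

lemma hasFDerivAt_bump {N : ℕ} {q : ℝ} (hq : 1 < q) (α β : ℝ) (z : EuclideanSpace ℝ (Fin N))
    {c : ℝ} (hc : 1 < c) (x : EuclideanSpace ℝ (Fin N)) :
    HasFDerivAt (bump q α β z c)
      ((c * bump q α β z (c - 1) x * β * q * ‖x - z‖ ^ (q - 2)) • innerSL ℝ (x - z)) x := by
  have h1 : HasFDerivAt (fun x : EuclideanSpace ℝ (Fin N) => ‖x - z‖ ^ q)
      ((q * ‖x - z‖ ^ (q - 2)) • innerSL ℝ (x - z)) x := by
    have := (hasFDerivAt_norm_rpow (x - z) hq).comp x ((hasFDerivAt_id x).sub_const z)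
    simpa [Function.comp_def] using this
  have h2 := (h1.const_mul β).const_add α
  have h3 := (hasDerivAt_posPow hc (α + β * ‖x - z‖ ^ q)).comp_hasFDerivAt x h2
  refine h3.congr_fderiv ?_
  simp only [smul_smul, bump]
  congr 1
  ring

lemma inner_gradient_eq_s18 {N : ℕ} (φ : EuclideanSpace ℝ (Fin N) → ℝ)
    (x v : EuclideanSpace ℝ (Fin N)) : ⟪v, gradient φ x⟫ = fderiv ℝ φ x v := by
  rw [real_inner_comm, gradient, InnerProductSpace.toDual_symm_apply]

/-- Integration by parts for the field `h(x) (x - z)`. -/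
lemma integral_by_parts {N : ℕ} {h φ : EuclideanSpace ℝ (Fin N) → ℝ} (hh : ContDiff ℝ 1 h)
    (hφ : ContDiff ℝ 1 φ) (hc : HasCompactSupport φ) (z : EuclideanSpace ℝ (Fin N)) :
    ∫ x, h x * ⟪x - z, gradient φ x⟫ =
      - ∫ x, (N * h x + fderiv ℝ h x (x - z)) * φ x := by
  let e : Fin N → EuclideanSpace ℝ (Fin N) := fun i => EuclideanSpace.single i 1
  have hexp : ∀ v : EuclideanSpace ℝ (Fin N), v = ∑ i, v i • e i := by
    intro v
    have := (EuclideanSpace.basisFun (Fin N) ℝ).sum_repr v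
    simpa [e] using this.symm
  have hL : ∀ (L : EuclideanSpace ℝ (Fin N) →L[ℝ] ℝ) v, L v = ∑ i, v i * L (e i) := by
    intro L v
    conv_lhs => rw [hexp v]
    simp
  have hhc := hh.continuous
  have hφc := hφ.continuous
  have hhd : Continuous (fderiv ℝ h) := hh.continuous_fderiv one_ne_zero
  have hφd : Continuous (fderiv ℝ φ) := hφ.continuous_fderiv one_ne_zero
  have hcoord : ∀ i, Continuous fun x : EuclideanSpace ℝ (Fin N) => (x - z) i := by
    intro i; fun_prop
  let k : Fin N → EuclideanSpace ℝ (Fin N) → ℝ := fun i x => h x * (x - z) i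
  have hcd : ∀ i x, HasFDerivAt (fun x : EuclideanSpace ℝ (Fin N) => (x - z) i)
      (EuclideanSpace.proj i : EuclideanSpace ℝ (Fin N) →L[ℝ] ℝ) x := by
    intro i x
    have := (EuclideanSpace.proj i : EuclideanSpace ℝ (Fin N) →L[ℝ] ℝ).hasFDerivAt.comp x
      ((hasFDerivAt_id x).sub_const z)
    simpa [Function.comp_def] using this
  have hk : ∀ i x, HasFDerivAt (k i) (h x • (EuclideanSpace.proj i : EuclideanSpace ℝ (Fin N) →L[ℝ] ℝ)
      + (x - z) i • fderiv ℝ h x) x := fun i x =>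
    ((hh.differentiable one_ne_zero x).hasFDerivAt).mul (hcd i x)
  have hk' : ∀ i x, fderiv ℝ (k i) x (e i) = h x + (x - z) i * fderiv ℝ h x (e i) := by
    intro i x
    rw [(hk i x).fderiv]
    simp [e]
  have hdcs : ∀ v, HasCompactSupport fun x => fderiv ℝ φ x v := fun v => hc.fderiv_apply ℝ v
  have i1 : ∀ i, Integrable (fun x => k i x * fderiv ℝ φ x (e i)) := by
    intro i
    refine Continuous.integrable_of_hasCompactSupport ?_ ((hdcs (e i)).mul_left)
    exact (hhc.mul (hcoord i)).mul (hφd.clm_apply continuous_const)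
  have i2 : ∀ i, Integrable (fun x => fderiv ℝ (k i) x (e i) * φ x) := by
    intro i
    simp_rw [hk']
    refine Continuous.integrable_of_hasCompactSupport ?_ hc.mul_left
    exact (hhc.add ((hcoord i).mul (hhd.clm_apply continuous_const))).mul hφc
  have i3 : ∀ i, Integrable (fun x => k i x * φ x) := by
    intro i
    refine Continuous.integrable_of_hasCompactSupport ?_ hc.mul_left
    exact (hhc.mul (hcoord i)).mul hφc
  calc ∫ x, h x * ⟪x - z, gradient φ x⟫
      = ∫ x, ∑ i, k i x * fderiv ℝ φ x (e i) := by
        congr 1; ext x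
        rw [inner_gradient_eq_s18, hL, Finset.mul_sum]
        exact Finset.sum_congr rfl fun i _ => by simp only [k]; ring
    _ = ∑ i, ∫ x, k i x * fderiv ℝ φ x (e i) := integral_finsetSum _ fun i _ => i1 i
    _ = ∑ i, - ∫ x, fderiv ℝ (k i) x (e i) * φ x := by
        refine Finset.sum_congr rfl fun i _ => ?_
        exact integral_mul_fderiv_eq_neg_fderiv_mul_of_integrable (i2 i) (i1 i) (i3 i)
          (fun x _ => (hk i x).differentiableAt) (fun x _ => hφ.differentiable one_ne_zero x)
    _ = - ∫ x, ∑ i, fderiv ℝ (k i) x (e i) * φ x := by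
        rw [integral_finsetSum _ fun i _ => i2 i, Finset.sum_neg_distrib]
    _ = _ := by
        congr 2; ext x
        rw [hL (fderiv ℝ h x), ← Finset.sum_mul]
        simp_rw [hk']
        simp [Finset.sum_add_distrib]

/-- The divergence computation for a single building block. -/
lemma bump_identity {N : ℕ} {q a α β : ℝ} (hq : 1 < q) (ha : 1 < a)
    (z x : EuclideanSpace ℝ (Fin N)) :
    N * bump q α β z a x + fderiv ℝ (bump q α β z a) x (x - z) =
      (N + a * q) * bump q α β z a x - a * q * α * bump q α β z (a - 1) x := by
  rw [(hasFDerivAt_bump hq α β z ha x).fderiv]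
  have e1 : ‖x - z‖ ^ (q - 2) * (‖x - z‖ * ‖x - z‖) = ‖x - z‖ ^ q := by
    rcases (norm_nonneg (x - z)).eq_or_lt with h | h
    · rw [← h, Real.zero_rpow (by linarith : q ≠ 0)]; ring
    · rw [← pow_two, ← Real.rpow_natCast, ← Real.rpow_add h]; norm_num
  have e2 : bump q α β z a x = bump q α β z (a - 1) x * (α + β * ‖x - z‖ ^ q) := by
    unfold bump
    rcases le_or_gt (α + β * ‖x - z‖ ^ q) 0 with h | h
    · rw [posPow_of_nonpos (by linarith) h, posPow_of_nonpos (by linarith) h, zero_mul]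
    · rw [posPow_of_nonneg h.le, posPow_of_nonneg h.le, ← Real.rpow_add_one h.ne']; norm_num
  simp only [_root_.smul_apply, smul_eq_mul, innerSL_apply_apply, real_inner_self_eq_norm_mul_norm]
  have : a * bump q α β z (a - 1) x * β * q * ‖x - z‖ ^ (q - 2) * (‖x - z‖ * ‖x - z‖)
      = a * q * (bump q α β z (a - 1) x * (β * ‖x - z‖ ^ q)) := by rw [← e1]; ring
  rw [this, e2]; ring

/-- `p`-Laplace flux of a building block gradient. -/
lemma gvec_block {N : ℕ} {p q s b m : ℝ} (hp : 2 < p) (hq : (q - 1) * (p - 1) = 1) (hs : 0 < s)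
    (hb : 0 < b) (hm : 0 ≤ m) (hs1 : 1 < s) (y : EuclideanSpace ℝ (Fin N)) :
    gvec (fun t : ℝ => t ^ (p - 1)) ((-(s * m ^ (s - 1) * b * q * ‖y‖ ^ (q - 2))) • y) =
      (-((s * q * b) ^ (p - 1) * m ^ ((s - 1) * (p - 1)))) • y := by
  have hq1 : 1 < q := by
    by_contra hcon
    have : (q - 1) * (p - 1) ≤ 0 := mul_nonpos_of_nonpos_of_nonneg (by linarith) (by linarith)
    linarith
  by_cases hy : y = 0
  · simp [hy, gvec]
  have hny : 0 < ‖y‖ := norm_pos_iff.2 hy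
  rcases hm.eq_or_lt with hm0 | hm0
  · rw [← hm0, Real.zero_rpow (by linarith : s - 1 ≠ 0),
      Real.zero_rpow (by nlinarith : (s - 1) * (p - 1) ≠ 0)]
    simp [gvec]
  set A := s * m ^ (s - 1) * b * q * ‖y‖ ^ (q - 2) with hA
  have hA0 : 0 < A := by positivity
  have hne : (-A) • y ≠ 0 := smul_ne_zero (by linarith) hy
  have hn : ‖(-A) • y‖ = A * ‖y‖ := by
    rw [norm_smul, Real.norm_eq_abs, abs_neg, abs_of_pos hA0]
  have hA2 : A * ‖y‖ = (s * q * b) * m ^ (s - 1) * ‖y‖ ^ (q - 1) := by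
    have : ‖y‖ ^ (q - 1) = ‖y‖ ^ (q - 2) * ‖y‖ := by
      rw [← Real.rpow_add_one hny.ne']; congr 1; ring
    rw [this, hA]; ring
  have hpow : (A * ‖y‖) ^ (p - 1) = (s * q * b) ^ (p - 1) * m ^ ((s - 1) * (p - 1)) * ‖y‖ := by
    rw [hA2, Real.mul_rpow (by positivity) (by positivity),
      Real.mul_rpow (by positivity) (by positivity), ← Real.rpow_mul hm, ← Real.rpow_mul hny.le,
      hq, Real.rpow_one]
  rw [gvec, if_neg hne, smul_smul]
  congr 1
  simp only [hn]
  rw [hpow]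
  field_simp

/-- Example 1.1, case (iii): for the `p`-Laplacian with `p > 2` and `s ≥ p/(p-2)` there is
a Lipschitz nonlinearity `f` and a positive `C¹` weak solution of `-Δ_p u = f(u)` in `B₆`,
vanishing on `∂B₆`, which is not radially symmetric. -/
theorem symmetry_breaking_lipschitz
    {N : ℕ} (hN : 2 ≤ N) (p s : ℝ) (hp : 2 < p) (hs : p / (p - 2) ≤ s) :
    ∃ (f : ℝ → ℝ) (u : EuclideanSpace ℝ (Fin N) → ℝ) (C : NNReal),
      LipschitzOnWith C f (Icc 0 2) ∧
      ContDiffOn ℝ 1 u (closedBall 0 6) ∧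
      (∀ x ∈ ball (0:EuclideanSpace ℝ (Fin N)) 6, 0 < u x) ∧
      (∀ x ∈ sphere (0:EuclideanSpace ℝ (Fin N)) 6, u x = 0) ∧
      (∀ x ∈ closedBall (0:EuclideanSpace ℝ (Fin N)) 6, u x ∈ Icc (0:ℝ) 2) ∧
      IsDistribSolAut (ball (0:EuclideanSpace ℝ (Fin N)) 6) (fun t : ℝ => t ^ (p - 1)) f u ∧
      ¬ ∃ U : ℝ → ℝ, ∀ x ∈ ball (0:EuclideanSpace ℝ (Fin N)) 6, u x = U ‖x‖ := by
  have hp1 : 0 < p - 1 := by linarith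
  have hp2 : 0 < p - 2 := by linarith
  obtain ⟨q, hqdef⟩ : ∃ q : ℝ, q = p / (p - 1) := ⟨_, rfl⟩
  have hq : (q - 1) * (p - 1) = 1 := by rw [hqdef]; field_simp; ring
  have hq1 : 1 < q := by rw [hqdef, lt_div_iff₀ hp1]; linarith
  obtain ⟨σ, hσdef⟩ : ∃ σ : ℝ, σ = 2 * p / (p - 2) := ⟨_, rfl⟩
  have hσ : σ * (p - 2) = 2 * p := by rw [hσdef]; field_simp
  have hσ1 : 1 < σ := by rw [hσdef, lt_div_iff₀ hp2]; linarith
  have hσ0 : 0 < σ := by linarith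
  obtain ⟨a, hadef⟩ : ∃ a : ℝ, a = (σ - 1) * (p - 1) := ⟨_, rfl⟩
  have haσ : σ < a - 1 := by rw [hadef]; nlinarith
  have ha1 : 1 < a := by linarith
  have hc1 : 1 < a / σ := by rw [lt_div_iff₀ hσ0]; linarith
  have hc2 : 1 < (a - 1) / σ := by rw [lt_div_iff₀ hσ0]; linarith
  obtain ⟨D, hDdef⟩ : ∃ D : ℝ, D = (6:ℝ) ^ q - 5 ^ q := ⟨_, rfl⟩
  have hD : 0 < D := by
    rw [hDdef]
    have : (5:ℝ) ^ q < 6 ^ q := Real.rpow_lt_rpow (by norm_num) (by norm_num) (by linarith)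
    linarith
  obtain ⟨z, hz⟩ : ∃ z : EuclideanSpace ℝ (Fin N), ‖z‖ = 3 :=
    ⟨EuclideanSpace.single ⟨0, by omega⟩ 3, by simp⟩
  obtain ⟨α, hα⟩ : ∃ α : ℝ, α = -(5 ^ q / D) := ⟨_, rfl⟩
  set B₁ : ℝ → EuclideanSpace ℝ (Fin N) → ℝ := bump q α (1 / D) 0 with hB₁
  set B₂ : ℝ → EuclideanSpace ℝ (Fin N) → ℝ := bump q 1 (-1) z with hB₂
  obtain ⟨K₁, hK₁⟩ : ∃ K : ℝ, K = (σ * q * (1 / D)) ^ (p - 1) := ⟨_, rfl⟩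
  obtain ⟨K₂, hK₂⟩ : ∃ K : ℝ, K = (σ * q * 1) ^ (p - 1) := ⟨_, rfl⟩
  have harg₁ : ∀ x : EuclideanSpace ℝ (Fin N),
      α + 1 / D * ‖x - 0‖ ^ q = (‖x‖ ^ q - 5 ^ q) / D := by
    intro x; rw [hα, sub_zero]; ring
  -- vanishing of the blocks
  have hB₁0 : ∀ c : ℝ, 0 < c → ∀ x : EuclideanSpace ℝ (Fin N), ‖x‖ ≤ 5 → B₁ c x = 0 := by
    intro c hc x hx
    refine posPow_of_nonpos hc.ne' ?_
    rw [harg₁]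
    have : ‖x‖ ^ q ≤ 5 ^ q := Real.rpow_le_rpow (norm_nonneg _) hx (by linarith)
    exact div_nonpos_of_nonpos_of_nonneg (by linarith) hD.le
  have hB₂0 : ∀ c : ℝ, 0 < c → ∀ x : EuclideanSpace ℝ (Fin N), 1 ≤ ‖x - z‖ → B₂ c x = 0 := by
    intro c hc x hx
    refine posPow_of_nonpos hc.ne' ?_
    have : 1 ≤ ‖x - z‖ ^ q := Real.one_le_rpow hx (by linarith)
    linarith
  have hdich : ∀ x : EuclideanSpace ℝ (Fin N), ‖x‖ ≤ 5 ∨ 1 ≤ ‖x - z‖ := by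
    intro x
    rcases le_or_gt ‖x‖ 5 with h | h
    · exact Or.inl h
    · right
      have := norm_sub_norm_le x z
      linarith
  have hBn₁ : ∀ c x, 0 ≤ B₁ c x := fun c x => posPow_nonneg _ _
  have hBn₂ : ∀ c x, 0 ≤ B₂ c x := fun c x => posPow_nonneg _ _
  have hB₂1 : ∀ x, B₂ σ x ≤ 1 := by
    intro x
    refine Real.rpow_le_one (le_max_right _ _) (max_le ?_ zero_le_one) hσ0.le
    have : 0 ≤ ‖x - z‖ ^ q := by positivity
    linarith
  have hB₁1 : ∀ x : EuclideanSpace ℝ (Fin N), ‖x‖ ≤ 6 → B₁ σ x ≤ 1 := by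
    intro x hx
    refine Real.rpow_le_one (le_max_right _ _) (max_le ?_ zero_le_one) hσ0.le
    rw [harg₁, div_le_one hD, hDdef]
    have : ‖x‖ ^ q ≤ 6 ^ q := Real.rpow_le_rpow (norm_nonneg _) hx (by linarith)
    linarith
  have hB₁lt : ∀ x : EuclideanSpace ℝ (Fin N), ‖x‖ < 6 → B₁ σ x < 1 := by
    intro x hx
    refine Real.rpow_lt_one (le_max_right _ _) (max_lt ?_ zero_lt_one) hσ0
    rw [harg₁, div_lt_one hD, hDdef]
    have : ‖x‖ ^ q < 6 ^ q := Real.rpow_lt_rpow (norm_nonneg _) hx (by linarith)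
    linarith
  -- powers of the blocks
  have hpp : ∀ c t : ℝ, posPow (c / σ) (posPow σ t) = posPow c t := by
    intro c t
    rw [posPow_of_nonneg (posPow_nonneg _ _)]
    unfold posPow
    rw [← Real.rpow_mul (le_max_right _ _)]
    congr 1
    field_simp
  have hpp₁ : ∀ c x, posPow (c / σ) (B₁ σ x) = B₁ c x := fun c x => hpp _ _
  have hpp₂ : ∀ c x, posPow (c / σ) (B₂ σ x) = B₂ c x := fun c x => hpp _ _
  set f : ℝ → ℝ := fun t =>
    K₁ * ((N + a * q) * posPow (a / σ) (1 - t) - a * q * α * posPow ((a - 1) / σ) (1 - t)) +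
    K₂ * ((N + a * q) * posPow (a / σ) (t - 1) - a * q * 1 * posPow ((a - 1) / σ) (t - 1)) with hf
  set u : EuclideanSpace ℝ (Fin N) → ℝ := fun x => 1 - B₁ σ x + B₂ σ x with hu
  have hfc : ContDiff ℝ 1 f := by
    have h1 : ContDiff ℝ 1 fun t : ℝ => 1 - t := by fun_prop
    have h2 : ContDiff ℝ 1 fun t : ℝ => t - 1 := by fun_prop
    have g1 := (contDiff_posPow hc1).comp h1
    have g2 := (contDiff_posPow hc2).comp h1
    have g3 := (contDiff_posPow hc1).comp h2
    have g4 := (contDiff_posPow hc2).comp h2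
    exact (contDiff_const.mul ((contDiff_const.mul g1).sub (contDiff_const.mul g2))).add
      (contDiff_const.mul ((contDiff_const.mul g3).sub (contDiff_const.mul g4)))
  have huc : ContDiff ℝ 1 u :=
    (contDiff_const.sub (contDiff_bump hq1 _ _ _ hσ1)).add (contDiff_bump hq1 _ _ _ hσ1)
  obtain ⟨C, hC⟩ := hfc.contDiffOn.exists_lipschitzOnWith one_ne_zero
    (convex_Icc (0:ℝ) 2) isCompact_Icc
  -- the right-hand side
  have hfu : ∀ x, f (u x) =
      K₁ * ((N + a * q) * B₁ a x - a * q * α * B₁ (a - 1) x) +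
      K₂ * ((N + a * q) * B₂ a x - a * q * 1 * B₂ (a - 1) x) := by
    intro x
    simp only [hf, hu]
    rcases hdich x with h | h
    · have h0 := hB₁0 σ hσ0 x h
      rw [hB₁0 a (by linarith) x h, hB₁0 (a - 1) (by linarith) x h, h0]
      have e1 : (1:ℝ) - (1 - 0 + B₂ σ x) ≤ 0 := by linarith [hBn₂ σ x]
      have e2 : (1:ℝ) - 0 + B₂ σ x - 1 = B₂ σ x := by ring
      rw [posPow_of_nonpos (by linarith) e1, posPow_of_nonpos (by linarith) e1, e2, hpp₂, hpp₂]
    · have h0 := hB₂0 σ hσ0 x h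
      rw [hB₂0 a (by linarith) x h, hB₂0 (a - 1) (by linarith) x h, h0]
      have e1 : (1:ℝ) - B₁ σ x + 0 - 1 ≤ 0 := by linarith [hBn₁ σ x]
      have e2 : (1:ℝ) - (1 - B₁ σ x + 0) = B₁ σ x := by ring
      rw [posPow_of_nonpos (by linarith) e1, posPow_of_nonpos (by linarith) e1, e2, hpp₁, hpp₁]
  -- the gradient
  have hgrad : ∀ x, gradient u x =
      (-(σ * B₁ (σ - 1) x * (1 / D) * q * ‖x - 0‖ ^ (q - 2))) • (x - 0) +
      (-(σ * B₂ (σ - 1) x * 1 * q * ‖x - z‖ ^ (q - 2))) • (x - z) := by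
    intro x
    refine HasGradientAt.gradient ?_
    rw [hasGradientAt_iff_hasFDerivAt]
    have h := ((hasFDerivAt_bump hq1 α (1 / D) 0 hσ1 x).const_sub 1).add
      (hasFDerivAt_bump hq1 1 (-1) z hσ1 x)
    refine h.congr_fderiv ?_
    ext v
    simp [inner_add_left, inner_smul_left, hB₁, hB₂]
  have hflux : ∀ x, gvec (fun t : ℝ => t ^ (p - 1)) (gradient u x) =
      (-(K₁ * B₁ a x)) • (x - 0) + (-(K₂ * B₂ a x)) • (x - z) := by
    intro x
    rw [hgrad]
    rcases hdich x with h | h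
    · rw [hB₁0 (σ - 1) (by linarith) x h, hB₁0 a (by linarith) x h]
      have := gvec_block hp hq hσ0 one_pos (le_max_right (1 + -1 * ‖x - z‖ ^ q) 0) hσ1 (x - z)
      simp only [mul_zero, zero_mul, neg_zero, zero_smul, zero_add]
      rw [hK₂, hadef]
      exact this
    · rw [hB₂0 (σ - 1) (by linarith) x h, hB₂0 a (by linarith) x h]
      have := gvec_block hp hq hσ0 (by positivity : 0 < 1 / D)
        (le_max_right (α + 1 / D * ‖x - 0‖ ^ q) 0) hσ1 (x - 0)
      simp only [mul_zero, zero_mul, neg_zero, zero_smul, add_zero]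
      rw [hK₁, hadef]
      exact this
  refine ⟨f, u, C, hC, huc.contDiffOn, ?_, ?_, ?_, ?_, ?_⟩
  · intro x hx
    rw [mem_ball_zero_iff] at hx
    have h1 := hB₁lt x hx
    have h2 := hBn₂ σ x
    simp only [hu]; linarith
  · intro x hx
    rw [mem_sphere_zero_iff_norm] at hx
    have h1 : B₁ σ x = 1 := by
      change posPow σ (α + 1 / D * ‖x - 0‖ ^ q) = 1
      rw [harg₁, hx, ← hDdef, div_self hD.ne', posPow_of_nonneg zero_le_one, Real.one_rpow]
    have h2 : B₂ σ x = 0 := by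
      refine hB₂0 σ hσ0 x ?_
      have := norm_sub_norm_le x z
      linarith
    simp only [hu, h1, h2]; norm_num
  · intro x hx
    rw [mem_closedBall_zero_iff] at hx
    have h1 := hB₁1 x hx
    have h2 := hBn₂ σ x
    have h3 := hB₂1 x
    have h4 := hBn₁ σ x
    simp only [hu, mem_Icc]; constructor <;> linarith
  · rintro φ ⟨hφ, hφc, hφs⟩
    have hφ1 : ContDiff ℝ 1 φ := hφ.of_le (by exact_mod_cast le_top)
    have hz1 : ∀ x, x ∉ ball (0:EuclideanSpace ℝ (Fin N)) 6 → φ x = 0 := fun x hx =>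
      image_eq_zero_of_notMem_tsupport fun h => hx (hφs h)
    have hz2 : ∀ x, x ∉ ball (0:EuclideanSpace ℝ (Fin N)) 6 → fderiv ℝ φ x = 0 := fun x hx =>
      image_eq_zero_of_notMem_tsupport fun h => hx (hφs (tsupport_fderiv_subset ℝ h))
    rw [setIntegral_eq_integral_of_forall_compl_eq_zero, setIntegral_eq_integral_of_forall_compl_eq_zero]
    rotate_left
    · intro x hx; rw [hz1 x hx, mul_zero]
    · intro x hx; rw [inner_gradient_eq_s18, hz2 x hx]; rfl
    have c₁ : ContDiff ℝ 1 (B₁ a) := contDiff_bump hq1 _ _ _ ha1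
    have c₂ : ContDiff ℝ 1 (B₂ a) := contDiff_bump hq1 _ _ _ ha1
    have I₁ := integral_by_parts c₁ hφ1 hφc 0
    have I₂ := integral_by_parts c₂ hφ1 hφc z
    simp_rw [hB₁, bump_identity hq1 ha1, ← hB₁] at I₁
    simp_rw [hB₂, bump_identity hq1 ha1, ← hB₂] at I₂
    have hφd : Continuous (fderiv ℝ φ) := hφ1.continuous_fderiv one_ne_zero
    have hdz : ∀ (B : EuclideanSpace ℝ (Fin N) → ℝ) (w : EuclideanSpace ℝ (Fin N)), Continuous B →
        Integrable fun x => B x * ⟪x - w, gradient φ x⟫ := by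
      intro B w hB
      simp_rw [inner_gradient_eq_s18]
      refine Continuous.integrable_of_hasCompactSupport
        (hB.mul (hφd.clm_apply (continuous_id.sub continuous_const))) ?_
      refine HasCompactSupport.mul_left ?_
      refine (hφc.fderiv ℝ).mono ?_
      intro x hx hx'
      apply hx
      simp [hx']
    have hdφ : ∀ (B : EuclideanSpace ℝ (Fin N) → ℝ), Continuous B →
        Integrable fun x => B x * φ x := fun B hB =>
      (hB.mul hφ1.continuous).integrable_of_hasCompactSupport hφc.mul_left
    have d₁ : Continuous (B₁ (a - 1)) := (contDiff_bump hq1 _ _ _ (by linarith)).continuous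
    have d₂ : Continuous (B₂ (a - 1)) := (contDiff_bump hq1 _ _ _ (by linarith)).continuous
    have J₁ := hdφ (fun x => (N + a * q) * B₁ a x - a * q * α * B₁ (a - 1) x)
      ((continuous_const.mul c₁.continuous).sub (continuous_const.mul d₁))
    have J₂ := hdφ (fun x => (N + a * q) * B₂ a x - a * q * 1 * B₂ (a - 1) x)
      ((continuous_const.mul c₂.continuous).sub (continuous_const.mul d₂))
    calc ∫ x, ⟪gvec (fun t : ℝ => t ^ (p - 1)) (gradient u x), gradient φ x⟫
        = ∫ x, ((-K₁) * (B₁ a x * ⟪x - 0, gradient φ x⟫)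
            + (-K₂) * (B₂ a x * ⟪x - z, gradient φ x⟫)) := by
          congr 1; ext x
          rw [hflux, inner_add_left, real_inner_smul_left, real_inner_smul_left]; ring
      _ = (-K₁) * (∫ x, B₁ a x * ⟪x - 0, gradient φ x⟫)
            + (-K₂) * ∫ x, B₂ a x * ⟪x - z, gradient φ x⟫ := by
          rw [integral_add ((hdz _ _ c₁.continuous).const_mul _)
            ((hdz _ _ c₂.continuous).const_mul _), integral_const_mul, integral_const_mul]
      _ = K₁ * (∫ x, ((N + a * q) * B₁ a x - a * q * α * B₁ (a - 1) x) * φ x)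
            + K₂ * ∫ x, ((N + a * q) * B₂ a x - a * q * 1 * B₂ (a - 1) x) * φ x := by
          rw [I₁, I₂]; ring
      _ = ∫ x, (K₁ * (((N + a * q) * B₁ a x - a * q * α * B₁ (a - 1) x) * φ x)
            + K₂ * (((N + a * q) * B₂ a x - a * q * 1 * B₂ (a - 1) x) * φ x)) := by
          rw [integral_add (J₁.const_mul _) (J₂.const_mul _), integral_const_mul,
            integral_const_mul]
      _ = ∫ x, f (u x) * φ x := by
          congr 1; ext x
          rw [hfu]; ring
  · rintro ⟨U, hU⟩
    have h1 := hU z (by rw [mem_ball_zero_iff, hz]; norm_num)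
    have h2 := hU (-z) (by rw [mem_ball_zero_iff, norm_neg, hz]; norm_num)
    rw [norm_neg, ← h1] at h2
    have e1 : B₁ σ z = 0 := hB₁0 σ hσ0 z (by rw [hz]; norm_num)
    have e2 : B₁ σ (-z) = 0 := hB₁0 σ hσ0 (-z) (by rw [norm_neg, hz]; norm_num)
    have e3 : B₂ σ (-z) = 0 := by
      refine hB₂0 σ hσ0 (-z) ?_
      rw [show -z - z = (-2 : ℝ) • z by rw [neg_smul, two_smul]; abel, norm_smul, hz]
      norm_num
    have e4 : B₂ σ z = 1 := by
      change posPow σ (1 + -1 * ‖z - z‖ ^ q) = 1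
      rw [sub_self, norm_zero, Real.zero_rpow (by linarith), mul_zero, add_zero,
        posPow_of_nonneg zero_le_one, Real.one_rpow]
    simp only [hu, e1, e2, e3, e4] at h2
    norm_num at h2
end
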